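/- arXiv:2208.09726 — 3 statements merged into one kernel-verified Lean document; each statement's English description precedes it below -/
import Mathlib

section
/- Let (Ω, Σ, μ) be a probability space and let (f_n)_{n≥1} be any sequence of non-negative real-valued random variables on Ω (no integrability or boundedness assumed). Then there exist a measurable function f : Ω → [0, +∞] and a strictly increasing map φ : ℕ → ℕ such that, setting g_n = f_{φ(n)}, for every strictly increasing map ψ : ℕ → ℕ and every bijection π : ℕ → ℕ, the Cesàro means (1/n) ∑_{k=1}^n g_{ψ(π(k))}(ω) converge to f(ω) in [0, +∞] for μ-almost every ω ∈ Ω (convergence to +∞ meaning the means tend to infinity). -/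
open MeasureTheory Filter Topology

/-- If `∑ v k / (k + 1) ^ 2` converges, then the normalised partial sums of `v` along a geometric
sequence of times are summable. -/
lemma summable_sum_range_floor_pow_div_sq {v : ℕ → ℝ} (hv : ∀ k, 0 ≤ v k)
    (hsum : Summable fun k : ℕ => v k / ((k : ℝ) + 1) ^ 2) {c : ℝ} (hc : 1 < c) :
    Summable fun l : ℕ => (∑ k ∈ Finset.range ⌊c ^ l⌋₊, v k) / (⌊c ^ l⌋₊ : ℝ) ^ 2 := by
  set C : ℝ := c ^ 5 * (c - 1)⁻¹ ^ 3 with hC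
  have hC0 : 0 ≤ C := by
    have : 0 < c - 1 := by linarith
    positivity
  refine summable_of_sum_range_le (c := 4 * C * ∑' k : ℕ, v k / ((k : ℝ) + 1) ^ 2)
    (fun l => div_nonneg (Finset.sum_nonneg fun k _ => hv k) (by positivity)) fun L => ?_
  set M := ⌊c ^ L⌋₊ with hM
  have hmono : ∀ l ∈ Finset.range L, ⌊c ^ l⌋₊ ≤ M := fun l hl =>
    Nat.floor_mono (pow_le_pow_right₀ hc.le (Finset.mem_range.1 hl).le)
  have hswap : ∑ l ∈ Finset.range L, (∑ k ∈ Finset.range ⌊c ^ l⌋₊, v k) / (⌊c ^ l⌋₊ : ℝ) ^ 2 =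
      ∑ k ∈ Finset.range M, v k *
        ∑ l ∈ Finset.range L with k < ⌊c ^ l⌋₊, 1 / (⌊c ^ l⌋₊ : ℝ) ^ 2 := by
    have : ∀ l ∈ Finset.range L, (∑ k ∈ Finset.range ⌊c ^ l⌋₊, v k) / (⌊c ^ l⌋₊ : ℝ) ^ 2 =
        ∑ k ∈ Finset.range M, if k < ⌊c ^ l⌋₊ then v k * (1 / (⌊c ^ l⌋₊ : ℝ) ^ 2) else 0 := by
      intro l hl
      rw [← Finset.sum_filter, Finset.sum_div]
      refine Finset.sum_congr ?_ fun k _ => by ring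
      ext k
      have := hmono l hl
      simp only [Finset.mem_range, Finset.mem_filter]
      omega
    rw [Finset.sum_congr rfl this, Finset.sum_comm]
    refine Finset.sum_congr rfl fun k _ => ?_
    rw [← Finset.sum_filter, Finset.mul_sum]
  rw [hswap]
  calc _ ≤ ∑ k ∈ Finset.range M, 4 * C * (v k / ((k : ℝ) + 1) ^ 2) := by
        refine Finset.sum_le_sum fun k _ => ?_
        have hk : (0 : ℝ) < ((k : ℝ) + 1) / 2 := by positivity
        have h1 := sum_div_nat_floor_pow_sq_le_div_sq L hk hc
        have h2 : ∑ l ∈ Finset.range L with k < ⌊c ^ l⌋₊, 1 / (⌊c ^ l⌋₊ : ℝ) ^ 2 ≤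
            ∑ l ∈ Finset.range L with ((k : ℝ) + 1) / 2 < ⌊c ^ l⌋₊,
              1 / (⌊c ^ l⌋₊ : ℝ) ^ 2 := by
          refine Finset.sum_le_sum_of_subset_of_nonneg (fun l hl => ?_)
            fun _ _ _ => by positivity
          simp only [Finset.mem_filter] at hl ⊢
          refine ⟨hl.1, ?_⟩
          have : (k : ℝ) + 1 ≤ (⌊c ^ l⌋₊ : ℝ) := by exact_mod_cast hl.2
          linarith
        calc _ ≤ v k * (C / (((k : ℝ) + 1) / 2) ^ 2) :=
              mul_le_mul_of_nonneg_left (h2.trans h1) (hv k)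
          _ = _ := by field_simp; ring
    _ = 4 * C * ∑ k ∈ Finset.range M, v k / ((k : ℝ) + 1) ^ 2 := by rw [Finset.mul_sum]
    _ ≤ _ := mul_le_mul_of_nonneg_left
        (hsum.sum_le_tsum _ fun k _ => div_nonneg (hv k) (by positivity)) (by positivity)

section

variable {Ω : Type*} [MeasurableSpace Ω] {ν : Measure Ω}

/-- Second moment bound for sums of nearly orthogonal variables. -/
lemma integral_sum_range_sq_le {Z : ℕ → Ω → ℝ} (hZ : ∀ k, MemLp (Z k) 2 ν) {δ : ℕ → ℝ}
    (hδ0 : ∀ k, 0 ≤ δ k) (hδ : Summable δ)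
    (horth : ∀ i j, i ≠ j → |∫ ω, Z i ω * Z j ω ∂ν| ≤ δ i * δ j) (n : ℕ) :
    ∫ ω, (∑ k ∈ Finset.range n, Z k ω) ^ 2 ∂ν ≤
      ∑ k ∈ Finset.range n, (∫ ω, Z k ω ^ 2 ∂ν + (∑' j, δ j) * δ k) := by
  have hZint : ∀ i j, Integrable (fun ω => Z i ω * Z j ω) ν := fun i j =>
    (hZ i).integrable_mul (hZ j)
  have hexp : ∫ ω, (∑ k ∈ Finset.range n, Z k ω) ^ 2 ∂ν =
      ∑ i ∈ Finset.range n, ∑ j ∈ Finset.range n, ∫ ω, Z i ω * Z j ω ∂ν := by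
    simp_rw [sq, Finset.sum_mul_sum]
    rw [integral_finsetSum _ fun i _ => integrable_finsetSum _ fun j _ => hZint i j]
    exact Finset.sum_congr rfl fun i _ => integral_finsetSum _ fun j _ => hZint i j
  rw [hexp]
  refine Finset.sum_le_sum fun i hi => ?_
  rw [← Finset.add_sum_erase _ _ hi]
  have h1 : ∑ j ∈ (Finset.range n).erase i, ∫ ω, Z i ω * Z j ω ∂ν ≤
      ∑ j ∈ (Finset.range n).erase i, δ i * δ j :=
    Finset.sum_le_sum fun j hj =>
      (le_abs_self _).trans (horth i j (Finset.ne_of_mem_erase hj).symm)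
  have h2 : ∑ j ∈ (Finset.range n).erase i, δ i * δ j ≤ (∑' j, δ j) * δ i := by
    rw [← Finset.mul_sum, mul_comm]
    exact mul_le_mul_of_nonneg_right (hδ.sum_le_tsum _ fun j _ => hδ0 j) (hδ0 i)
  simp only [sq]
  linarith

/-- Strong law along geometric times for nearly orthogonal variables. -/
lemma ae_tendsto_sum_range_floor_pow_div {Z : ℕ → Ω → ℝ} (hZ : ∀ k, MemLp (Z k) 2 ν) {δ : ℕ → ℝ}
    (hδ0 : ∀ k, 0 ≤ δ k) (hδ : Summable δ)
    (horth : ∀ i j, i ≠ j → |∫ ω, Z i ω * Z j ω ∂ν| ≤ δ i * δ j)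
    (hvar : Summable fun k : ℕ => (∫ ω, Z k ω ^ 2 ∂ν) / ((k : ℝ) + 1) ^ 2)
    {c : ℝ} (hc : 1 < c) :
    ∀ᵐ ω ∂ν, Tendsto (fun l : ℕ => (∑ k ∈ Finset.range ⌊c ^ l⌋₊, Z k ω) / (⌊c ^ l⌋₊ : ℝ))
      atTop (𝓝 0) := by
  have hD : 0 ≤ ∑' j, δ j := tsum_nonneg hδ0
  set v : ℕ → ℝ := fun k => ∫ ω, Z k ω ^ 2 ∂ν + (∑' j, δ j) * δ k with hv_def
  have hv : ∀ k, 0 ≤ v k := fun k =>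
    add_nonneg (integral_nonneg fun ω => sq_nonneg _) (mul_nonneg hD (hδ0 k))
  have hvs : Summable fun k : ℕ => v k / ((k : ℝ) + 1) ^ 2 := by
    simp only [hv_def, add_div]
    refine hvar.add (Summable.of_nonneg_of_le
      (fun k => div_nonneg (mul_nonneg hD (hδ0 k)) (by positivity)) (fun k => ?_)
      (hδ.mul_left (∑' j, δ j)))
    refine div_le_self (mul_nonneg hD (hδ0 k)) ?_
    exact one_le_pow₀ (by linarith [(Nat.cast_nonneg k : (0 : ℝ) ≤ k)])
  have hsum := summable_sum_range_floor_pow_div_sq hv hvs hc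
  set A : ℕ → Ω → ℝ := fun l ω => (∑ k ∈ Finset.range ⌊c ^ l⌋₊, Z k ω) / (⌊c ^ l⌋₊ : ℝ) with hA
  have hAmem : ∀ l, MemLp (A l) 2 ν := fun l => by
    simp only [hA, div_eq_mul_inv]
    exact (memLp_finsetSum _ fun k _ => hZ k).mul_const _
  have hAint : ∀ l, ∫ ω, A l ω ^ 2 ∂ν ≤
      (∑ k ∈ Finset.range ⌊c ^ l⌋₊, v k) / (⌊c ^ l⌋₊ : ℝ) ^ 2 := fun l => by
    simp only [hA, div_pow, integral_div]
    gcongr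
    exact integral_sum_range_sq_le hZ hδ0 hδ horth _
  have hfin : ∑' l, ∫⁻ ω, ENNReal.ofReal (A l ω ^ 2) ∂ν ≠ ⊤ := by
    have : ∀ l, ∫⁻ ω, ENNReal.ofReal (A l ω ^ 2) ∂ν ≤
        ENNReal.ofReal ((∑ k ∈ Finset.range ⌊c ^ l⌋₊, v k) / (⌊c ^ l⌋₊ : ℝ) ^ 2) := fun l => by
      rw [← ofReal_integral_eq_lintegral_ofReal (hAmem l).integrable_sq
        (Eventually.of_forall fun ω => sq_nonneg _)]
      exact ENNReal.ofReal_le_ofReal (hAint l)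
    exact ne_top_of_le_ne_top hsum.tsum_ofReal_ne_top (ENNReal.tsum_le_tsum this)
  rw [← lintegral_tsum fun l =>
    ((hAmem l).integrable_sq.aestronglyMeasurable.aemeasurable).ennreal_ofReal] at hfin
  filter_upwards [ae_lt_top' (AEMeasurable.tsum fun l =>
    ((hAmem l).integrable_sq.aestronglyMeasurable.aemeasurable).ennreal_ofReal) hfin] with ω hω
  have h0 := ENNReal.tendsto_atTop_zero_of_tsum_ne_top hω.ne
  have h1 : Tendsto (fun l => A l ω ^ 2) atTop (𝓝 0) := by
    have := (ENNReal.tendsto_toReal ENNReal.zero_ne_top).comp h0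
    simpa [Function.comp_def, ENNReal.toReal_ofReal, sq_nonneg] using this
  have h2 := h1.sqrt
  simp only [Real.sqrt_sq_eq_abs, Real.sqrt_zero] at h2
  exact (tendsto_zero_iff_abs_tendsto_zero _).2 h2

/-- Strong law for non-negative variables which are nearly orthogonal after subtraction of
almost everywhere convergent centerings. -/
lemma ae_tendsto_sum_range_div_of_centered {Y H : ℕ → Ω → ℝ} {G : Ω → ℝ}
    (hY : ∀ k ω, 0 ≤ Y k ω) (hH : ∀ᵐ ω ∂ν, Tendsto (fun k => H k ω) atTop (𝓝 (G ω)))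
    (hZ : ∀ k, MemLp (fun ω => Y k ω - H k ω) 2 ν) {δ : ℕ → ℝ}
    (hδ0 : ∀ k, 0 ≤ δ k) (hδ : Summable δ)
    (horth : ∀ i j, i ≠ j → |∫ ω, (Y i ω - H i ω) * (Y j ω - H j ω) ∂ν| ≤ δ i * δ j)
    (hvar : Summable fun k : ℕ => (∫ ω, (Y k ω - H k ω) ^ 2 ∂ν) / ((k : ℝ) + 1) ^ 2) :
    ∀ᵐ ω ∂ν, Tendsto (fun n : ℕ => (∑ k ∈ Finset.range n, Y k ω) / (n : ℝ)) atTop (𝓝 (G ω)) := by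
  set c : ℕ → ℝ := fun i => 1 + 1 / ((i : ℝ) + 1) with hc_def
  have hc : ∀ i, 1 < c i := fun i => by
    have : (0 : ℝ) < 1 / ((i : ℝ) + 1) := by positivity
    simp only [hc_def]; linarith
  have hclim : Tendsto c atTop (𝓝 1) := by
    simpa [hc_def] using (tendsto_one_div_add_atTop_nhds_zero_nat (𝕜 := ℝ)).const_add 1
  have hae := ae_all_iff.2 fun i => ae_tendsto_sum_range_floor_pow_div hZ hδ0 hδ horth hvar (hc i)
  filter_upwards [hae, hH] with ω hω hHω
  refine tendsto_div_of_monotone_of_tendsto_div_floor_pow _ _ ?_ c hc hclim fun i => ?_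
  · exact monotone_nat_of_le_succ fun n => by
      rw [Finset.sum_range_succ]; linarith [hY n ω]
  · have hces := hHω.cesaro.comp ((tendsto_nat_floor_atTop (α := ℝ)).comp
      (tendsto_pow_atTop_atTop_of_one_lt (hc i)))
    have := (hω i).add hces
    rw [zero_add] at this
    refine this.congr fun l => ?_
    simp only [Function.comp_apply, Finset.sum_sub_distrib]
    ring

end

/-- Sequential weak compactness in a Hilbert space, for countably many bounded sequences
simultaneously. -/
lemma exists_strictMono_tendsto_inner {H : Type*} [NormedAddCommGroup H] [InnerProductSpace ℝ H]
    [CompleteSpace H] (x : ℕ → ℕ → H) (C : ℕ → ℝ) (hx : ∀ m i, ‖x m i‖ ≤ C m) :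
    ∃ (y : ℕ → H) (θ : ℕ → ℕ), StrictMono θ ∧
      ∀ m u, Tendsto (fun i => inner ℝ (x m (θ i)) u) atTop (𝓝 (inner ℝ (y m) u)) := by
  set S : Set H := Set.range fun p : ℕ × ℕ => x p.1 p.2
  set K : Submodule ℝ H := (Submodule.span ℝ S).topologicalClosure with hK
  have hsep : TopologicalSpace.IsSeparable (K : Set H) := by
    rw [hK, Submodule.topologicalClosure_coe]
    exact ((Set.countable_range _).isSeparable.span (R := ℝ)).closure
  have : TopologicalSpace.SeparableSpace K := hsep.separableSpace
  have : CompleteSpace K := (Submodule.isClosed_topologicalClosure _).completeSpace_coe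
  have hmem : ∀ m i, x m i ∈ K := fun m i =>
    Submodule.le_topologicalClosure _ (Submodule.subset_span ⟨(m, i), rfl⟩)
  set B : ℕ → Set (WeakDual ℝ K) := fun m =>
    WeakDual.toStrongDual ⁻¹' Metric.closedBall (0 : StrongDual ℝ K) (C m) with hB
  have hBc : ∀ m, IsCompact (B m) := fun m => WeakDual.isCompact_closedBall _ _
  have : ∀ m, CompactSpace (B m) := fun m => isCompact_iff_compactSpace.1 (hBc m)
  have : ∀ m, TopologicalSpace.MetrizableSpace (B m) := fun m =>
    WeakDual.metrizable_of_isCompact ℝ K _ (hBc m)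
  let z : ℕ → (m : ℕ) → B m := fun i m =>
    ⟨StrongDual.toWeakDual (InnerProductSpace.toDual ℝ K ⟨x m i, hmem m i⟩), by
      change InnerProductSpace.toDual ℝ K ⟨x m i, hmem m i⟩ ∈ Metric.closedBall _ _
      rw [mem_closedBall_zero_iff, LinearIsometryEquiv.norm_map]
      exact hx m i⟩
  obtain ⟨a, θ, hθ, ha⟩ := CompactSpace.tendsto_subseq z
  refine ⟨fun m =>
    ((InnerProductSpace.toDual ℝ K).symm (WeakDual.toStrongDual (a m : WeakDual ℝ K)) : K),
    θ, hθ, fun m u => ?_⟩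
  have h1 : Tendsto (fun i => ((z (θ i) m : B m) : WeakDual ℝ K)) atTop
      (𝓝 (a m : WeakDual ℝ K)) :=
    (continuous_subtype_val.tendsto _).comp ((tendsto_pi_nhds.1 ha) m)
  have h2 := ((WeakDual.eval_continuous (K.orthogonalProjectionOnto u)).tendsto _).comp h1
  have h3 : ∀ k : K, inner ℝ (k : H) u = inner ℝ k (K.orthogonalProjectionOnto u) := fun k => by
    rw [Submodule.inner_orthogonalProjectionOnto_eq_of_mem_left]
  rw [h3, InnerProductSpace.toDual_symm_apply]
  exact h2.congr fun i => (h3 ⟨x m (θ i), hmem m (θ i)⟩).symm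

section

variable {Ω : Type*} [MeasurableSpace Ω] {μ : Measure Ω}

lemma memLp_min_natCast [IsFiniteMeasure μ] {x : Ω → ℝ} (hx : Measurable x) (hx0 : ∀ ω, 0 ≤ x ω)
    (p : ENNReal) (m : ℕ) : MemLp (fun ω => min (x ω) (m : ℝ)) p μ :=
  MemLp.of_bound (hx.min measurable_const).aestronglyMeasurable m
    (Eventually.of_forall fun ω => by
      rw [Real.norm_of_nonneg (le_min (hx0 ω) (by positivity))]
      exact min_le_right _ _)

/-- Pointwise inequalities pass to weak limits. -/
lemma ae_le_of_tendsto_setIntegral {a b : Ω → ℝ} {s t : ℕ → Ω → ℝ} (ha : Integrable a μ)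
    (hb : Integrable b μ) (hs : ∀ i, Integrable (s i) μ) (ht : ∀ i, Integrable (t i) μ)
    (hst : ∀ i ω, s i ω ≤ t i ω)
    (hsa : ∀ E, MeasurableSet E →
      Tendsto (fun i => ∫ ω in E, s i ω ∂μ) atTop (𝓝 (∫ ω in E, a ω ∂μ)))
    (htb : ∀ E, MeasurableSet E →
      Tendsto (fun i => ∫ ω in E, t i ω ∂μ) atTop (𝓝 (∫ ω in E, b ω ∂μ))) :
    a ≤ᵐ[μ] b :=
  ae_le_of_forall_setIntegral_le ha hb fun E hE _ =>
    le_of_tendsto_of_tendsto' (hsa E hE) (htb E hE) fun i =>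
      integral_mono (hs i).integrableOn (ht i).integrableOn (hst i)

/-- Along a subsequence, all truncations of a sequence of non-negative random variables converge
weakly in `L²`, and the limits can be chosen to be increasing in the truncation level. -/
lemma exists_weak_limits_of_truncations [IsFiniteMeasure μ] {f : ℕ → Ω → ℝ}
    (hf : ∀ n, Measurable (f n)) (hf0 : ∀ n ω, 0 ≤ f n ω) :
    ∃ (θ : ℕ → ℕ) (h : ℕ → Ω → ℝ), StrictMono θ ∧ (∀ m, Measurable (h m)) ∧
      (∀ m ω, 0 ≤ h m ω) ∧ (∀ m ω, h m ω ≤ m) ∧ (∀ ω, Monotone fun m => h m ω) ∧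
      ∀ (m : ℕ) u, MemLp u 2 μ → Tendsto (fun i => ∫ ω, min (f (θ i) ω) m * u ω ∂μ) atTop
        (𝓝 (∫ ω, h m ω * u ω ∂μ)) := by
  have hmem : ∀ (m i : ℕ), MemLp (fun ω => min (f i ω) (m : ℝ)) 2 μ := fun m i =>
    memLp_min_natCast (hf i) (hf0 i) 2 m
  obtain ⟨y, θ, hθ, hy⟩ := exists_strictMono_tendsto_inner
    (fun m i => (hmem m i).toLp _)
    (fun m => μ.real Set.univ ^ ((2 : ENNReal).toReal⁻¹) * m) (fun m i => by
      refine Lp.norm_le_of_ae_bound (by positivity) ?_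
      filter_upwards [(hmem m i).coeFn_toLp] with ω hω
      rw [hω, Real.norm_of_nonneg (le_min (hf0 i ω) (by positivity))]
      exact min_le_right _ _)
  set h₀ : ℕ → Ω → ℝ := fun m => (Lp.aestronglyMeasurable (y m)).mk (y m) with hh₀
  have hh₀m : ∀ m, Measurable (h₀ m) := fun m =>
    (Lp.aestronglyMeasurable (y m)).stronglyMeasurable_mk.measurable
  have hh₀y : ∀ m, (y m : Ω → ℝ) =ᵐ[μ] h₀ m := fun m => (Lp.aestronglyMeasurable (y m)).ae_eq_mk
  have hh₀L : ∀ m, MemLp (h₀ m) 2 μ := fun m => (Lp.memLp (y m)).ae_eq (hh₀y m)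
  have hlim : ∀ (m : ℕ) u, MemLp u 2 μ → Tendsto (fun i => ∫ ω, min (f (θ i) ω) m * u ω ∂μ) atTop
      (𝓝 (∫ ω, h₀ m ω * u ω ∂μ)) := by
    intro m u hu
    have h1 := hy m (hu.toLp u)
    simp only [L2.inner_def] at h1
    have e1 : ∫ ω, inner ℝ ((y m : Ω → ℝ) ω) ((hu.toLp u : Ω → ℝ) ω) ∂μ
        = ∫ ω, h₀ m ω * u ω ∂μ := by
      refine integral_congr_ae ?_
      filter_upwards [hh₀y m, hu.coeFn_toLp] with ω e1 e2
      rw [e1, e2]; simp [mul_comm]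
    rw [e1] at h1
    refine h1.congr fun i => integral_congr_ae ?_
    filter_upwards [(hmem m (θ i)).coeFn_toLp, hu.coeFn_toLp] with ω e1 e2
    rw [e1, e2]; simp [mul_comm]
  have hset : ∀ (m : ℕ) E, MeasurableSet E → Tendsto (fun i => ∫ ω in E, min (f (θ i) ω) m ∂μ) atTop
      (𝓝 (∫ ω in E, h₀ m ω ∂μ)) := by
    intro m E hE
    have h1 := hlim m (E.indicator fun _ => 1)
      (memLp_indicator_const 2 hE (1 : ℝ) (Or.inr (measure_ne_top _ _)))
    have e : ∀ g : Ω → ℝ, ∫ ω, g ω * E.indicator (fun _ => (1 : ℝ)) ω ∂μ = ∫ ω in E, g ω ∂μ :=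
      fun g => by
        rw [← integral_indicator hE]
        congr 1; ext ω
        by_cases hω : ω ∈ E <;> simp [hω]
    simpa only [e] using h1
  have hZint : ∀ m, Integrable (h₀ m) μ := fun m => (hh₀L m).integrable (by norm_num)
  have hZint' : ∀ (m i : ℕ), Integrable (fun ω => min (f (θ i) ω) (m : ℝ)) μ := fun m i =>
    (hmem m (θ i)).integrable (by norm_num)
  have hgood : ∀ᵐ ω ∂μ, ∀ m, 0 ≤ h₀ m ω ∧ h₀ m ω ≤ m ∧ h₀ m ω ≤ h₀ (m + 1) ω := by
    rw [ae_all_iff]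
    intro m
    have a1 : (fun _ => (0 : ℝ)) ≤ᵐ[μ] h₀ m :=
      ae_le_of_tendsto_setIntegral (integrable_const _) (hZint m) (fun _ => integrable_const 0)
        (hZint' m) (fun i ω => le_min (hf0 _ _) (by positivity)) (fun _ _ => tendsto_const_nhds)
        (hset m)
    have a2 : h₀ m ≤ᵐ[μ] fun _ => (m : ℝ) :=
      ae_le_of_tendsto_setIntegral (hZint m) (integrable_const _) (hZint' m)
        (fun _ => integrable_const (m : ℝ)) (fun i ω => min_le_right _ _)
        (hset m) (fun _ _ => tendsto_const_nhds)
    have a3 : h₀ m ≤ᵐ[μ] h₀ (m + 1) :=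
      ae_le_of_tendsto_setIntegral (hZint m) (hZint (m + 1)) (hZint' m) (hZint' (m + 1))
        (fun i ω => min_le_min_left _ (by push_cast; linarith)) (hset m) (hset (m + 1))
    filter_upwards [a1, a2, a3] with ω b1 b2 b3 using ⟨b1, b2, b3⟩
  set E : Set Ω := {ω | ∀ m, 0 ≤ h₀ m ω ∧ h₀ m ω ≤ m ∧ h₀ m ω ≤ h₀ (m + 1) ω} with hE
  have hEm : MeasurableSet E := by
    simp only [hE, Set.ofPred_forall]
    exact MeasurableSet.iInter fun m => (measurableSet_le measurable_const (hh₀m m)).inter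
      ((measurableSet_le (hh₀m m) measurable_const).inter (measurableSet_le (hh₀m m) (hh₀m (m + 1))))
  refine ⟨θ, fun m => E.indicator (h₀ m), hθ, fun m => (hh₀m m).indicator hEm,
    fun m ω => ?_, fun m ω => ?_, fun ω => monotone_nat_of_le_succ fun m => ?_, fun m u hu => ?_⟩
  · exact Set.indicator_nonneg (fun ω hω => (hω m).1) ω
  · by_cases hω : ω ∈ E
    · simpa [hω] using (hω m).2.1
    · simp [hω]
  · by_cases hω : ω ∈ E
    · simpa [hω] using (hω m).2.2
    · simp [hω]
  · have e : ∫ ω, E.indicator (h₀ m) ω * u ω ∂μ = ∫ ω, h₀ m ω * u ω ∂μ := by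
      refine integral_congr_ae ?_
      filter_upwards [hgood] with ω hω
      rw [Set.indicator_of_mem (show ω ∈ E from hω)]
    rw [e]
    exact hlim m u hu

end

section

variable {Ω : Type*} [MeasurableSpace Ω] {ν : Measure Ω} {g h : ℕ → Ω → ℝ} {σ c : ℕ → ℕ}

lemma norm_min_natCast_sub_le {x y : ℝ} {m : ℕ} (hx : 0 ≤ x) (hy : 0 ≤ y) (hym : y ≤ m) :
    ‖min x (m : ℝ) - y‖ ≤ m := by
  have h1 : 0 ≤ min x (m : ℝ) := le_min hx (by positivity)
  have h2 : min x (m : ℝ) ≤ m := min_le_right _ _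
  rw [Real.norm_eq_abs, abs_le]
  constructor <;> linarith

lemma memLp_min_sub [IsFiniteMeasure ν] (hg : ∀ n, Measurable (g n)) (hg0 : ∀ n ω, 0 ≤ g n ω)
    (hh : ∀ m, Measurable (h m)) (hh0 : ∀ m ω, 0 ≤ h m ω) (hhle : ∀ m ω, h m ω ≤ m)
    (p : ENNReal) (n m : ℕ) : MemLp (fun ω => min (g n ω) (m : ℝ) - h m ω) p ν :=
  MemLp.of_bound (((hg n).min measurable_const).sub (hh m)).aestronglyMeasurable m
    (Eventually.of_forall fun ω => norm_min_natCast_sub_le (hg0 n ω) (hh0 m ω) (hhle m ω))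

/-- Near orthogonality is insensitive to rearrangement. -/
lemma abs_integral_mul_le_of_injective (hσ : Function.Injective σ) (hc : ∀ k, c k ≤ σ k + 1)
    (horth : ∀ a b, a < b → ∀ p q : ℕ, p ≤ b + 1 → q ≤ b + 1 →
      |∫ ω, (min (g a ω) (p : ℝ) - h p ω) * (min (g b ω) (q : ℝ) - h q ω) ∂ν| ≤ (1 / 4) ^ b)
    (i j : ℕ) (hij : i ≠ j) :
    |∫ ω, (min (g (σ i) ω) (c i : ℝ) - h (c i) ω) * (min (g (σ j) ω) (c j : ℝ) - h (c j) ω) ∂ν| ≤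
      (1 / 2) ^ σ i * (1 / 2) ^ σ j := by
  have key : ∀ a b : ℕ, a < b → ((1 : ℝ) / 4) ^ b ≤ (1 / 2) ^ a * (1 / 2) ^ b := fun a b hab => by
    have : ((1 : ℝ) / 4) ^ b = (1 / 2) ^ b * (1 / 2) ^ b := by rw [← mul_pow]; norm_num
    rw [this]
    gcongr ?_ * _
    exact pow_le_pow_of_le_one (by norm_num) (by norm_num) hab.le
  rcases lt_or_gt_of_ne (hσ.ne hij) with hlt | hlt
  · exact (horth _ _ hlt _ _ ((hc i).trans (by omega)) (hc j)).trans (key _ _ hlt)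
  · rw [mul_comm ((1 / 2 : ℝ) ^ σ i)]
    simp_rw [mul_comm (min (g (σ i) _) (c i : ℝ) - h (c i) _)]
    exact (horth _ _ hlt _ _ ((hc j).trans (by omega)) (hc i)).trans (key _ _ hlt)

lemma summable_half_pow_comp (hσ : Function.Injective σ) :
    Summable fun k => ((1 : ℝ) / 2) ^ σ k :=
  (summable_geometric_of_lt_one (by norm_num) (by norm_num : (1 : ℝ) / 2 < 1)).comp_injective hσ

/-- Where the truncated weak limits are unbounded, the Cesàro means tend to infinity. -/
lemma ae_tendsto_atTop_of_tendsto_atTop [IsFiniteMeasure ν]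
    (hg : ∀ n, Measurable (g n)) (hg0 : ∀ n ω, 0 ≤ g n ω)
    (hh : ∀ m, Measurable (h m)) (hh0 : ∀ m ω, 0 ≤ h m ω) (hhle : ∀ m ω, h m ω ≤ m)
    (horth : ∀ a b, a < b → ∀ p q : ℕ, p ≤ b + 1 → q ≤ b + 1 →
      |∫ ω, (min (g a ω) (p : ℝ) - h p ω) * (min (g b ω) (q : ℝ) - h q ω) ∂ν| ≤ (1 / 4) ^ b)
    (hσ : Function.Injective σ) :
    ∀ᵐ ω ∂ν, Tendsto (fun m => h m ω) atTop atTop →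
      Tendsto (fun n : ℕ => (∑ k ∈ Finset.range n, g (σ k) ω) / (n : ℝ)) atTop atTop := by
  have hlim : ∀ m : ℕ, ∀ᵐ ω ∂ν, Tendsto (fun n : ℕ => (∑ k ∈ Finset.range n,
      min (g (σ k) ω) ((min m (σ k + 1) : ℕ) : ℝ)) / (n : ℝ)) atTop (𝓝 (h m ω)) := by
    intro m
    set c : ℕ → ℕ := fun k => min m (σ k + 1) with hc
    refine ae_tendsto_sum_range_div_of_centered (H := fun k => h (c k))
      (fun k ω => le_min (hg0 _ _) (by positivity)) (Eventually.of_forall fun ω => ?_)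
      (fun k => memLp_min_sub hg hg0 hh hh0 hhle 2 (σ k) (c k))
      (δ := fun k => (1 / 2) ^ σ k) (fun k => by positivity) (summable_half_pow_comp hσ)
      (abs_integral_mul_le_of_injective hσ (fun k => min_le_right _ _) horth) ?_
    · refine tendsto_const_nhds.congr' ?_
      filter_upwards [hσ.nat_tendsto_atTop.eventually_ge_atTop m] with k hk
      have : c k = m := min_eq_left (by omega)
      rw [this]
    · have hs : Summable fun k : ℕ => ((m : ℝ) ^ 2 * ν.real Set.univ) * (1 / ((k : ℝ) + 1) ^ 2) := by
        have := (summable_nat_add_iff 1).2 (Real.summable_one_div_nat_pow.2 (one_lt_two))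
        refine Summable.mul_left _ ?_
        simpa using this
      refine Summable.of_nonneg_of_le
        (fun k => div_nonneg (integral_nonneg fun ω => sq_nonneg _) (by positivity))
        (fun k => ?_) hs
      rw [mul_one_div]
      gcongr
      have hb : ∀ ω, (min (g (σ k) ω) (c k : ℝ) - h (c k) ω) ^ 2 ≤ (m : ℝ) ^ 2 := fun ω => by
        have h1 := norm_min_natCast_sub_le (hg0 (σ k) ω) (hh0 (c k) ω) (hhle (c k) ω)
        have h2 : (c k : ℝ) ≤ m := by exact_mod_cast min_le_left _ _
        exact sq_le_sq' (by linarith [(abs_le.1 (Real.norm_eq_abs _ ▸ h1)).1])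
          (by linarith [(abs_le.1 (Real.norm_eq_abs _ ▸ h1)).2])
      calc _ ≤ ∫ _, (m : ℝ) ^ 2 ∂ν := integral_mono_of_nonneg
            (Eventually.of_forall fun ω => sq_nonneg _) (integrable_const _)
            (Eventually.of_forall hb)
        _ = _ := by simp [mul_comm]
  filter_upwards [ae_all_iff.2 hlim] with ω hω hω'
  refine tendsto_atTop.2 fun b => ?_
  obtain ⟨m, hm⟩ := (hω'.eventually_gt_atTop b).exists
  filter_upwards [(hω m).eventually (lt_mem_nhds hm)] with n hn
  refine hn.le.trans ?_
  gcongr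
  exact min_le_left _ _

lemma min_natCast_sq_le_sum {x : ℝ} (hx : 0 ≤ x) (k : ℕ) :
    min x (k : ℝ) ^ 2 ≤
      ∑ j ∈ Finset.range k, 2 * ((j : ℝ) + 1) * (min x ((j + 1 : ℕ) : ℝ) - min x (j : ℝ)) := by
  induction k with
  | zero => simp [hx]
  | succ k ih =>
    rw [Finset.sum_range_succ]
    have h1 : min x (k : ℝ) ≤ min x ((k + 1 : ℕ) : ℝ) := min_le_min_left _ (by push_cast; linarith)
    have h2 : min x ((k + 1 : ℕ) : ℝ) ≤ (k : ℝ) + 1 := by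
      have := min_le_right x ((k + 1 : ℕ) : ℝ)
      push_cast at this ⊢
      exact this
    nlinarith

lemma sum_weighted_sum_div_sq_le {d : ℕ → ℝ} (hd : ∀ j, 0 ≤ d j) (K : ℕ) :
    ∑ k ∈ Finset.range K, (∑ j ∈ Finset.range (k + 1), ((j : ℝ) + 1) * d j) / ((k : ℝ) + 1) ^ 2 ≤
      2 * ∑ j ∈ Finset.range K, d j - (∑ j ∈ Finset.range K, ((j : ℝ) + 1) * d j) / K := by
  induction K with
  | zero => simp
  | succ K ih =>
    rw [Finset.sum_range_succ, Finset.sum_range_succ d, Finset.sum_range_succ _ K]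
    set B := ∑ j ∈ Finset.range K, ((j : ℝ) + 1) * d j with hB
    have hB0 : 0 ≤ B := Finset.sum_nonneg fun j _ => mul_nonneg (by positivity) (hd j)
    have hdK := hd K
    have hK : (0 : ℝ) ≤ K := Nat.cast_nonneg K
    push_cast
    have e1 : (B + ((K : ℝ) + 1) * d K) / ((K : ℝ) + 1) ^ 2 = B / ((K : ℝ) + 1) ^ 2 + d K / (K + 1) := by
      field_simp
    have e2 : (B + ((K : ℝ) + 1) * d K) / ((K : ℝ) + 1) = B / ((K : ℝ) + 1) + d K := by
      field_simp
    have e3 : d K / ((K : ℝ) + 1) ≤ d K := div_le_self hdK (by linarith)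
    have e4 : B / ((K : ℝ) + 1) ^ 2 + B / ((K : ℝ) + 1) ≤ B / K := by
      rcases Nat.eq_zero_or_pos K with rfl | hpos
      · simp [hB]
      · have hpos' : (0 : ℝ) < K := by exact_mod_cast hpos
        rw [div_add_div _ _ (by positivity) (by positivity), div_le_div_iff₀ (by positivity) hpos']
        have : 0 ≤ B * ((K : ℝ) + 1) := by positivity
        nlinarith
    rw [e1, e2]
    linarith

lemma summable_weighted_sum_div_sq {d : ℕ → ℝ} (hd : ∀ j, 0 ≤ d j) (hdS : Summable d) :
    Summable fun k : ℕ =>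
      (∑ j ∈ Finset.range (k + 1), ((j : ℝ) + 1) * d j) / ((k : ℝ) + 1) ^ 2 := by
  have hnn : ∀ s : Finset ℕ, 0 ≤ ∑ j ∈ s, ((j : ℝ) + 1) * d j := fun s =>
    Finset.sum_nonneg fun j _ => mul_nonneg (by positivity) (hd j)
  refine summable_of_sum_range_le (c := 2 * ∑' j, d j)
    (fun k => div_nonneg (hnn _) (by positivity)) fun K => ?_
  have h1 := sum_weighted_sum_div_sq_le hd K
  have h2 : 0 ≤ (∑ j ∈ Finset.range K, ((j : ℝ) + 1) * d j) / K :=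
    div_nonneg (hnn _) (by positivity)
  linarith [hdS.sum_le_tsum (Finset.range K) fun j _ => hd j]

/-- Second moment bound for a truncated variable in terms of bounds on its tails. -/
lemma integral_min_natCast_sq_le [IsFiniteMeasure ν] {x : Ω → ℝ} (hx : Measurable x)
    (hx0 : ∀ ω, 0 ≤ x ω) {d : ℕ → ℝ} (hd : ∀ j, 0 ≤ d j) {ε : ℝ} (hε : 0 ≤ ε) {e k : ℕ}
    (hek : e ≤ k)
    (htail : ∀ j ≤ e, ∫ ω, (min (x ω) ((j + 1 : ℕ) : ℝ) - min (x ω) (j : ℝ)) ∂ν ≤ d j + ε) :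
    ∫ ω, min (x ω) ((e + 1 : ℕ) : ℝ) ^ 2 ∂ν ≤
      2 * ∑ j ∈ Finset.range (k + 1), ((j : ℝ) + 1) * d j + 2 * ((k : ℝ) + 1) ^ 2 * ε := by
  have hZint : ∀ j : ℕ, Integrable (fun ω => 2 * ((j : ℝ) + 1) *
      (min (x ω) ((j + 1 : ℕ) : ℝ) - min (x ω) (j : ℝ))) ν := fun j =>
    (((memLp_min_natCast hx hx0 1 (j + 1)).integrable le_rfl).sub
      ((memLp_min_natCast hx hx0 1 j).integrable le_rfl)).const_mul _
  calc ∫ ω, min (x ω) ((e + 1 : ℕ) : ℝ) ^ 2 ∂ν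
      ≤ ∫ ω, ∑ j ∈ Finset.range (e + 1), 2 * ((j : ℝ) + 1) *
          (min (x ω) ((j + 1 : ℕ) : ℝ) - min (x ω) (j : ℝ)) ∂ν :=
        integral_mono (memLp_min_natCast hx hx0 2 _).integrable_sq
          (integrable_finsetSum _ fun j _ => hZint j)
          fun ω => min_natCast_sq_le_sum (hx0 ω) _
    _ = ∑ j ∈ Finset.range (e + 1), 2 * ((j : ℝ) + 1) *
          ∫ ω, (min (x ω) ((j + 1 : ℕ) : ℝ) - min (x ω) (j : ℝ)) ∂ν := by
        rw [integral_finsetSum _ fun j _ => hZint j]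
        exact Finset.sum_congr rfl fun j _ => integral_const_mul _ _
    _ ≤ ∑ j ∈ Finset.range (e + 1), 2 * ((j : ℝ) + 1) * (d j + ε) :=
        Finset.sum_le_sum fun j hj => mul_le_mul_of_nonneg_left
          (htail _ (Nat.lt_succ_iff.1 (Finset.mem_range.1 hj))) (by positivity)
    _ ≤ ∑ j ∈ Finset.range (k + 1), 2 * ((j : ℝ) + 1) * (d j + ε) := by
        refine Finset.sum_le_sum_of_subset_of_nonneg
          (Finset.range_mono (Nat.succ_le_succ hek)) fun j _ _ => ?_
        have := hd j
        positivity
    _ = 2 * ∑ j ∈ Finset.range (k + 1), ((j : ℝ) + 1) * d j +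
          ∑ j ∈ Finset.range (k + 1), 2 * ((j : ℝ) + 1) * ε := by
        rw [Finset.mul_sum, ← Finset.sum_add_distrib]
        exact Finset.sum_congr rfl fun j _ => by ring
    _ ≤ _ := by
        gcongr
        calc _ ≤ ∑ j ∈ Finset.range (k + 1), 2 * ((k : ℝ) + 1) * ε := by
              refine Finset.sum_le_sum fun j hj => ?_
              have : (j : ℝ) ≤ k := by exact_mod_cast Nat.lt_succ_iff.1 (Finset.mem_range.1 hj)
              gcongr
          _ = _ := by
              rw [Finset.sum_const, Finset.card_range, nsmul_eq_mul]; push_cast; ring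

lemma tendsto_sum_range_div_of_eventuallyEq {u v : ℕ → ℝ} {l : ℝ} (huv : ∀ᶠ k in atTop, u k = v k)
    (hv : Tendsto (fun n : ℕ => (∑ k ∈ Finset.range n, v k) / (n : ℝ)) atTop (𝓝 l)) :
    Tendsto (fun n : ℕ => (∑ k ∈ Finset.range n, u k) / (n : ℝ)) atTop (𝓝 l) := by
  have h0 : Tendsto (fun k => u k - v k) atTop (𝓝 0) :=
    tendsto_const_nhds.congr' (huv.mono fun k hk => by simp [hk])
  have := h0.cesaro.add hv
  rw [zero_add] at this
  refine this.congr fun n => ?_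
  rw [Finset.sum_sub_distrib]
  ring

/-- If the truncated weak limits converge to a square integrable function, then so do the Cesàro
means, almost everywhere. -/
lemma ae_tendsto_of_memLp_two [IsFiniteMeasure ν] {G : Ω → ℝ}
    (hg : ∀ n, Measurable (g n)) (hg0 : ∀ n ω, 0 ≤ g n ω)
    (hh : ∀ m, Measurable (h m)) (hh0 : ∀ m ω, 0 ≤ h m ω) (hhle : ∀ m ω, h m ω ≤ m)
    (hmono : ∀ ω, Monotone fun m => h m ω)
    (hG : MemLp G 2 ν) (hhG : ∀ᵐ ω ∂ν, Tendsto (fun m => h m ω) atTop (𝓝 (G ω)))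
    (horth : ∀ a b, a < b → ∀ p q : ℕ, p ≤ b + 1 → q ≤ b + 1 →
      |∫ ω, (min (g a ω) (p : ℝ) - h p ω) * (min (g b ω) (q : ℝ) - h q ω) ∂ν| ≤ (1 / 4) ^ b)
    (htail : ∀ n j : ℕ, j ≤ n → ∫ ω, (min (g n ω) ((j + 1 : ℕ) : ℝ) - min (g n ω) (j : ℝ)) ∂ν ≤
      ∫ ω, (h (j + 1) ω - h j ω) ∂ν + (1 / 2) ^ n)
    (hσ : Function.Injective σ) :
    ∀ᵐ ω ∂ν, Tendsto (fun n : ℕ => (∑ k ∈ Finset.range n, g (σ k) ω) / (n : ℝ)) atTop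
      (𝓝 (G ω)) := by
  have hhG' : ∀ᵐ ω ∂ν, ∀ m, h m ω ≤ G ω := hhG.mono fun ω hω m => (hmono ω).ge_of_tendsto hω m
  have hGint : Integrable G ν := hG.integrable (by norm_num)
  have hhint : ∀ m, Integrable (h m) ν := fun m =>
    Integrable.of_bound (hh m).aestronglyMeasurable m (Eventually.of_forall fun ω => by
      rw [Real.norm_of_nonneg (hh0 m ω)]; exact hhle m ω)
  have hgL : ∀ n m : ℕ, MemLp (fun ω => min (g n ω) (m : ℝ)) 2 ν := fun n m =>
    memLp_min_natCast (hg n) (hg0 n) 2 m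
  have hgint : ∀ n m : ℕ, Integrable (fun ω => min (g n ω) (m : ℝ)) ν := fun n m =>
    (hgL n m).integrable (by norm_num)
  set d : ℕ → ℝ := fun j => ∫ ω, (h (j + 1) ω - h j ω) ∂ν with hd_def
  have hd : ∀ j, 0 ≤ d j := fun j =>
    integral_nonneg fun ω => sub_nonneg.2 (hmono ω (Nat.le_succ j))
  have hdsum : ∀ K, ∑ j ∈ Finset.range K, d j ≤ ∫ ω, G ω ∂ν := fun K => by
    have : ∀ j, d j = ∫ ω, h (j + 1) ω ∂ν - ∫ ω, h j ω ∂ν := fun j =>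
      integral_sub (hhint _) (hhint _)
    simp_rw [this]
    rw [Finset.sum_range_sub fun j => ∫ ω, h j ω ∂ν]
    have h1 : 0 ≤ ∫ ω, h 0 ω ∂ν := integral_nonneg (hh0 0)
    have h2 : ∫ ω, h K ω ∂ν ≤ ∫ ω, G ω ∂ν :=
      integral_mono_ae (hhint K) hGint (hhG'.mono fun ω hω => hω K)
    linarith
  have hdS : Summable d := summable_of_sum_range_le hd hdsum
  have hδS := summable_half_pow_comp hσ
  set e : ℕ → ℕ := fun k => min k (σ k) with he
  have he1 : ∀ k, e k ≤ k := fun k => min_le_left _ _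
  have he2 : ∀ k, e k ≤ σ k := fun k => min_le_right _ _
  have he_top : Tendsto (fun k => e k + 1) atTop atTop :=
    tendsto_atTop.2 fun b => by
      filter_upwards [eventually_ge_atTop b, hσ.nat_tendsto_atTop.eventually_ge_atTop b]
        with k h1 h2
      exact (le_min h1 h2).trans (Nat.le_succ _)
  -- the truncated variables satisfy the strong law
  have hY : ∀ᵐ ω ∂ν, Tendsto (fun n : ℕ => (∑ k ∈ Finset.range n,
      min (g (σ k) ω) ((e k + 1 : ℕ) : ℝ)) / (n : ℝ)) atTop (𝓝 (G ω)) := by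
    refine ae_tendsto_sum_range_div_of_centered (H := fun k => h (e k + 1))
      (fun k ω => le_min (hg0 _ _) (by positivity)) (hhG.mono fun ω hω => hω.comp he_top)
      (fun k => memLp_min_sub hg hg0 hh hh0 hhle 2 (σ k) (e k + 1))
      (δ := fun k => (1 / 2) ^ σ k) (fun k => by positivity) hδS
      (abs_integral_mul_le_of_injective (c := fun k => e k + 1) hσ
        (fun k => Nat.succ_le_succ (he2 k)) horth) ?_
    have hsq : ∀ k : ℕ, ∫ ω, min (g (σ k) ω) ((e k + 1 : ℕ) : ℝ) ^ 2 ∂ν ≤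
        2 * ∑ j ∈ Finset.range (k + 1), ((j : ℝ) + 1) * d j +
          2 * ((k : ℝ) + 1) ^ 2 * (1 / 2) ^ σ k := fun k =>
      integral_min_natCast_sq_le (hg _) (hg0 _) hd (by positivity) (he1 k)
        fun j hj => htail _ _ (hj.trans (he2 k))
    have hA := summable_weighted_sum_div_sq hd hdS
    have hB : Summable fun k : ℕ => 1 / ((k : ℝ) + 1) ^ 2 := by
      simpa using (summable_nat_add_iff 1).2 (Real.summable_one_div_nat_pow.2 one_lt_two)
    refine Summable.of_nonneg_of_le
      (fun k => div_nonneg (integral_nonneg fun ω => sq_nonneg _) (by positivity)) (fun k => ?_)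
      (((hA.mul_left 4).add (hδS.mul_left 4)).add (hB.mul_left (2 * ∫ ω, G ω ^ 2 ∂ν)))
    have hZ : ∫ ω, (min (g (σ k) ω) ((e k + 1 : ℕ) : ℝ) - h (e k + 1) ω) ^ 2 ∂ν ≤
        2 * ∫ ω, min (g (σ k) ω) ((e k + 1 : ℕ) : ℝ) ^ 2 ∂ν + 2 * ∫ ω, G ω ^ 2 ∂ν := by
      rw [← integral_const_mul, ← integral_const_mul, ← integral_add
        ((hgL _ _).integrable_sq.const_mul _) (hG.integrable_sq.const_mul _)]
      refine integral_mono_ae (memLp_min_sub hg hg0 hh hh0 hhle 2 (σ k) (e k + 1)).integrable_sq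
        (((hgL _ _).integrable_sq.const_mul _).add (hG.integrable_sq.const_mul _)) ?_
      filter_upwards [hhG'] with ω hω
      have h1 := hω (e k + 1)
      have h2 := hh0 (e k + 1) ω
      have h3 : h (e k + 1) ω ^ 2 ≤ G ω ^ 2 := pow_le_pow_left₀ h2 h1 2
      nlinarith [sq_nonneg (min (g (σ k) ω) ((e k + 1 : ℕ) : ℝ) + h (e k + 1) ω)]
    calc _ ≤ (2 * (2 * ∑ j ∈ Finset.range (k + 1), ((j : ℝ) + 1) * d j +
          2 * ((k : ℝ) + 1) ^ 2 * (1 / 2) ^ σ k) + 2 * ∫ ω, G ω ^ 2 ∂ν) / ((k : ℝ) + 1) ^ 2 := by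
          gcongr
          linarith [hsq k]
      _ = _ := by field_simp; ring
  -- the truncation is active only finitely often
  have hBC : ∀ᵐ ω ∂ν, ∀ᶠ k in atTop, g (σ k) ω = min (g (σ k) ω) ((e k + 1 : ℕ) : ℝ) := by
    set s : ℕ → Set Ω := fun k =>
      {ω | 1 ≤ min (g (σ k) ω) ((e k + 1 : ℕ) : ℝ) - min (g (σ k) ω) (e k : ℝ)} with hs
    have hsum : Summable fun k => ν.real (s k) := by
      refine Summable.of_nonneg_of_le (fun k => measureReal_nonneg) (fun k => ?_)
        ((hdS.add (hdS.comp_injective hσ)).add hδS)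
      have h1 := mul_meas_ge_le_integral_of_nonneg (μ := ν)
        (f := fun ω => min (g (σ k) ω) ((e k + 1 : ℕ) : ℝ) - min (g (σ k) ω) (e k : ℝ))
        (Eventually.of_forall fun ω => sub_nonneg.2 (min_le_min_left _ (by push_cast; linarith)))
        ((hgint _ _).sub (hgint _ _)) 1
      rw [one_mul] at h1
      have h2 := htail (σ k) (e k) (he2 k)
      have h3 : d (e k) ≤ d k + d (σ k) := by
        rcases min_choice k (σ k) with h' | h' <;> simp only [he, h'] <;>
          linarith [hd k, hd (σ k)]
      have h4 : (d ∘ σ) k = d (σ k) := rfl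
      rw [h4]
      exact h1.trans (h2.trans (by linarith))
    have hne : ∑' k, ν (s k) ≠ ⊤ := by
      have : ∀ k, ν (s k) = ENNReal.ofReal (ν.real (s k)) := fun k =>
        (ofReal_measureReal).symm
      simp_rw [this]
      exact hsum.tsum_ofReal_ne_top
    filter_upwards [ae_eventually_notMem hne] with ω hω
    filter_upwards [hω] with k hk
    by_contra hne'
    have hlt : ((e k + 1 : ℕ) : ℝ) < g (σ k) ω := by
      by_contra hle
      exact hne' (min_eq_left (not_lt.1 hle)).symm
    apply hk
    push_cast at hlt
    simp only [hs, Set.mem_ofPred_eq]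
    push_cast
    rw [min_eq_right hlt.le, min_eq_right (by linarith)]
    linarith
  filter_upwards [hY, hBC] with ω h1 h2
  exact tendsto_sum_range_div_of_eventuallyEq h2 h1

end

/-- Diagonal extraction in which the choice of each term may depend on the earlier terms. -/
lemma exists_strictMono_of_eventually {R : ℕ → ℕ → ℕ → Prop} {Q : ℕ → ℕ → Prop}
    (hR : ∀ n a, ∀ᶠ i in atTop, R n a i) (hQ : ∀ n, ∀ᶠ i in atTop, Q n i) :
    ∃ φ : ℕ → ℕ, StrictMono φ ∧ (∀ n, Q n (φ n)) ∧ ∀ a b, a < b → R b (φ a) (φ b) := by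
  have hE : ∀ n B, ∃ N, ∀ i ≥ N, Q n i ∧ ∀ a ∈ Finset.range (B + 1), R n a i := fun n B =>
    eventually_atTop.1 ((hQ n).and ((eventually_all_finset _).2 fun a _ => hR n a))
  choose N hN using hE
  set φ : ℕ → ℕ := fun n => Nat.rec (N 0 0) (fun n b => max (b + 1) (N (n + 1) b)) n with hφ
  have hφs : ∀ n, φ (n + 1) = max (φ n + 1) (N (n + 1) (φ n)) := fun n => rfl
  have hmono : StrictMono φ := strictMono_nat_of_lt_succ fun n => by
    rw [hφs]; exact lt_of_lt_of_le (Nat.lt_succ_self _) (le_max_left _ _)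
  refine ⟨φ, hmono, fun n => ?_, fun a b hab => ?_⟩
  · cases n with
    | zero => exact (hN 0 0 _ le_rfl).1
    | succ n => exact (hN (n + 1) (φ n) _ (by rw [hφs]; exact le_max_right _ _)).1
  · obtain ⟨n, rfl⟩ : ∃ n, b = n + 1 := ⟨b - 1, by omega⟩
    refine (hN (n + 1) (φ n) _ (by rw [hφs]; exact le_max_right _ _)).2 _ ?_
    exact Finset.mem_range.2 (Nat.lt_succ_of_le (hmono.monotone (by omega)))

section

variable {Ω : Type*} [MeasurableSpace Ω] {ρ : Measure Ω} [IsFiniteMeasure ρ] {f h : ℕ → Ω → ℝ}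

lemma eventually_abs_integral_mul_le
    (hf : ∀ n, Measurable (f n)) (hf0 : ∀ n ω, 0 ≤ f n ω)
    (hh : ∀ m, Measurable (h m)) (hh0 : ∀ m ω, 0 ≤ h m ω) (hhle : ∀ m ω, h m ω ≤ m)
    (hweak : ∀ (m : ℕ) (u : Ω → ℝ), Measurable u → (∃ C, ∀ ω, ‖u ω‖ ≤ C) →
      Tendsto (fun i => ∫ ω, min (f i ω) (m : ℝ) * u ω ∂ρ) atTop (𝓝 (∫ ω, h m ω * u ω ∂ρ)))
    {ε : ℝ} (hε : 0 < ε) (n a : ℕ) :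
    ∀ᶠ i in atTop, ∀ p q : ℕ, p ≤ n → q ≤ n →
      |∫ ω, (min (f a ω) (p : ℝ) - h p ω) * (min (f i ω) (q : ℝ) - h q ω) ∂ρ| ≤ ε := by
  have hpq : ∀ p q : ℕ, ∀ᶠ i in atTop,
      |∫ ω, (min (f a ω) (p : ℝ) - h p ω) * (min (f i ω) (q : ℝ) - h q ω) ∂ρ| ≤ ε := by
    intro p q
    have hu : Measurable fun ω => min (f a ω) (p : ℝ) - h p ω :=
      ((hf a).min measurable_const).sub (hh p)
    have hub : ∀ ω, ‖min (f a ω) (p : ℝ) - h p ω‖ ≤ p := fun ω =>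
      norm_min_natCast_sub_le (hf0 a ω) (hh0 p ω) (hhle p ω)
    have h1 := (hweak q _ hu ⟨p, hub⟩).sub_const (∫ ω, h q ω * (min (f a ω) (p : ℝ) - h p ω) ∂ρ)
    rw [sub_self] at h1
    have h2 := h1.abs
    rw [abs_zero] at h2
    filter_upwards [h2.eventually (gt_mem_nhds hε)] with i hi
    have huL : MemLp (fun ω => min (f a ω) (p : ℝ) - h p ω) 2 ρ :=
      memLp_min_sub hf hf0 hh hh0 hhle 2 a p
    have hhL : MemLp (h q) 2 ρ := MemLp.of_bound (hh q).aestronglyMeasurable q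
      (Eventually.of_forall fun ω => by rw [Real.norm_of_nonneg (hh0 q ω)]; exact hhle q ω)
    have e := integral_sub ((memLp_min_natCast (hf i) (hf0 i) 2 q).integrable_mul huL)
      (hhL.integrable_mul huL)
    simp only [Pi.mul_apply, ← sub_mul] at e
    rw [← e] at hi
    simpa only [mul_comm] using hi.le
  have := (eventually_all_finset (Finset.range (n + 1))).2 fun p _ =>
    (eventually_all_finset (Finset.range (n + 1))).2 fun q _ => hpq p q
  filter_upwards [this] with i hi p q hp hq
  exact hi p (Finset.mem_range.2 (by omega)) q (Finset.mem_range.2 (by omega))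

lemma eventually_integral_min_sub_min_le
    (hf : ∀ n, Measurable (f n)) (hf0 : ∀ n ω, 0 ≤ f n ω)
    (hh : ∀ m, Measurable (h m)) (hh0 : ∀ m ω, 0 ≤ h m ω) (hhle : ∀ m ω, h m ω ≤ m)
    (hweak : ∀ (m : ℕ) (u : Ω → ℝ), Measurable u → (∃ C, ∀ ω, ‖u ω‖ ≤ C) →
      Tendsto (fun i => ∫ ω, min (f i ω) (m : ℝ) * u ω ∂ρ) atTop (𝓝 (∫ ω, h m ω * u ω ∂ρ)))
    {ε : ℝ} (hε : 0 < ε) (n : ℕ) :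
    ∀ᶠ i in atTop, ∀ j : ℕ, j ≤ n →
      ∫ ω, (min (f i ω) ((j + 1 : ℕ) : ℝ) - min (f i ω) (j : ℝ)) ∂ρ ≤
        ∫ ω, (h (j + 1) ω - h j ω) ∂ρ + ε := by
  have hconv : ∀ m : ℕ, Tendsto (fun i => ∫ ω, min (f i ω) (m : ℝ) ∂ρ) atTop
      (𝓝 (∫ ω, h m ω ∂ρ)) := fun m => by
    simpa using hweak m (fun _ => 1) measurable_const ⟨1, fun _ => by simp⟩
  have hhint : ∀ m, Integrable (h m) ρ := fun m =>
    Integrable.of_bound (hh m).aestronglyMeasurable m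
      (Eventually.of_forall fun ω => by rw [Real.norm_of_nonneg (hh0 m ω)]; exact hhle m ω)
  have hfint : ∀ i m : ℕ, Integrable (fun ω => min (f i ω) (m : ℝ)) ρ := fun i m =>
    (memLp_min_natCast (hf i) (hf0 i) 1 m).integrable le_rfl
  have hj : ∀ j : ℕ, ∀ᶠ i in atTop,
      ∫ ω, (min (f i ω) ((j + 1 : ℕ) : ℝ) - min (f i ω) (j : ℝ)) ∂ρ ≤
        ∫ ω, (h (j + 1) ω - h j ω) ∂ρ + ε := by
    intro j
    rw [integral_sub (hhint _) (hhint _)]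
    filter_upwards [((hconv (j + 1)).sub (hconv j)).eventually
      (gt_mem_nhds (lt_add_of_pos_right _ hε))] with i hi
    rw [integral_sub (hfint _ _) (hfint _ _)]
    exact hi.le
  filter_upwards [(eventually_all_finset (Finset.range (n + 1))).2 fun j _ => hj j]
    with i hi j hjn
  exact hi j (Finset.mem_range.2 (by omega))

end

/-- Permutation-invariant Komlós-type theorem for non-negative random variables:
every sequence of non-negative random variables has a subsequence `g` such that the
Cesàro means of every permuted subsequence of `g` converge a.e. to a fixed
`[0, ∞]`-valued measurable function. -/
theorem komlos_nonneg_perm_invariant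
    {Ω : Type*} [MeasurableSpace Ω] (μ : Measure Ω) [IsProbabilityMeasure μ]
    (f : ℕ → Ω → ℝ) (hmeas : ∀ n, Measurable (f n)) (hnonneg : ∀ n ω, 0 ≤ f n ω) :
    ∃ (F : Ω → ENNReal), Measurable F ∧ ∃ φ : ℕ → ℕ, StrictMono φ ∧
      ∀ ψ : ℕ → ℕ, StrictMono ψ → ∀ π : ℕ → ℕ, Function.Bijective π →
        ∀ᵐ ω ∂μ, Tendsto
          (fun n : ℕ => ENNReal.ofReal ((∑ k ∈ Finset.range n, f (φ (ψ (π k))) ω) / n))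
          atTop (𝓝 (F ω)) := by
  obtain ⟨θ, h, hθ, hh, hh0, hhle, hmono, hlim⟩ :=
    exists_weak_limits_of_truncations (μ := μ) hmeas hnonneg
  set F : Ω → ENNReal := fun ω => ⨆ m, ENNReal.ofReal (h m ω) with hF
  have hFm : Measurable F := Measurable.iSup fun m => (hh m).ennreal_ofReal
  have hFlim : ∀ ω, Tendsto (fun m => ENNReal.ofReal (h m ω)) atTop (𝓝 (F ω)) := fun ω =>
    tendsto_atTop_iSup fun a b hab => ENNReal.ofReal_le_ofReal (hmono ω hab)
  have hFtop : ∀ ω, F ω = ⊤ → Tendsto (fun m => h m ω) atTop atTop := fun ω hω => by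
    have h1 := hFlim ω
    rw [hω] at h1
    exact ENNReal.tendsto_ofReal_nhds_top.1 h1
  have hFfin : ∀ ω, F ω ≠ ⊤ → Tendsto (fun m => h m ω) atTop (𝓝 (F ω).toReal) := fun ω hω => by
    have h1 := (ENNReal.tendsto_toReal hω).comp (hFlim ω)
    simpa [Function.comp_def, ENNReal.toReal_ofReal, hh0] using h1
  -- an equivalent weight on `{F ≠ ⊤}` for which `F` is square integrable
  set w : Ω → ENNReal := fun ω => ((1 + F ω)⁻¹) ^ 2 with hw
  have hwm : Measurable w := ((hFm.const_add 1).inv).pow_const 2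
  have hw1 : ∀ ω, w ω ≤ 1 := fun ω =>
    pow_le_one₀ zero_le (ENNReal.inv_le_one.2 le_self_add)
  have hwtop : ∀ ω, w ω < ⊤ := fun ω => (hw1 ω).trans_lt ENNReal.one_lt_top
  have hw0 : ∀ ω, w ω ≠ 0 ↔ F ω ≠ ⊤ := fun ω => by simp [hw]
  set ν : Measure Ω := μ.withDensity w with hν
  have hνfin : IsFiniteMeasure ν := isFiniteMeasure_withDensity
    (ne_top_of_le_ne_top (by simp) (lintegral_mono hw1))
  have hνae : ∀ {p : Ω → Prop}, (∀ᵐ ω ∂ν, p ω) ↔ ∀ᵐ ω ∂μ, F ω ≠ ⊤ → p ω := by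
    intro p
    rw [hν, ae_withDensity_iff hwm]
    simp only [hw0]
  have hG : MemLp (fun ω => (F ω).toReal) 2 ν := by
    rw [memLp_two_iff_integrable_sq hFm.ennreal_toReal.aestronglyMeasurable, hν,
      integrable_withDensity_iff hwm (Eventually.of_forall hwtop)]
    refine Integrable.of_bound
      ((hFm.ennreal_toReal.pow_const 2).mul hwm.ennreal_toReal).aestronglyMeasurable 1
      (Eventually.of_forall fun ω => ?_)
    rw [Real.norm_of_nonneg (by positivity)]
    by_cases hω : F ω = ⊤
    · simp [hω]
    · have h0 : 0 ≤ (F ω).toReal := ENNReal.toReal_nonneg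
      have e : (w ω).toReal = (1 + (F ω).toReal)⁻¹ ^ 2 := by
        simp [hw, ENNReal.toReal_add, hω]
      rw [e, ← mul_pow, ← div_eq_mul_inv]
      exact pow_le_one₀ (by positivity) ((div_le_one (by positivity)).2 (by linarith))
  -- weak convergence with respect to both measures
  have hweakμ : ∀ (m : ℕ) (u : Ω → ℝ), Measurable u → (∃ C, ∀ ω, ‖u ω‖ ≤ C) →
      Tendsto (fun i => ∫ ω, min (f (θ i) ω) (m : ℝ) * u ω ∂μ) atTop
        (𝓝 (∫ ω, h m ω * u ω ∂μ)) := fun m u hu ⟨C, hC⟩ =>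
    hlim m u (MemLp.of_bound hu.aestronglyMeasurable C (Eventually.of_forall hC))
  have hweakν : ∀ (m : ℕ) (u : Ω → ℝ), Measurable u → (∃ C, ∀ ω, ‖u ω‖ ≤ C) →
      Tendsto (fun i => ∫ ω, min (f (θ i) ω) (m : ℝ) * u ω ∂ν) atTop
        (𝓝 (∫ ω, h m ω * u ω ∂ν)) := by
    rintro m u hu ⟨C, hC⟩
    have h1 := hweakμ m (fun ω => (w ω).toReal * u ω) (hwm.ennreal_toReal.mul hu) ⟨C, fun ω => by
      rw [norm_mul, Real.norm_of_nonneg ENNReal.toReal_nonneg]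
      refine (mul_le_of_le_one_left (norm_nonneg _) ?_).trans (hC ω)
      exact ENNReal.toReal_le_of_le_ofReal zero_le_one (by simpa using hw1 ω)⟩
    simp only [hν, integral_withDensity_eq_integral_toReal_smul hwm (Eventually.of_forall hwtop),
      smul_eq_mul]
    simpa only [mul_left_comm] using h1
  have hf' : ∀ i, Measurable (f (θ i)) := fun i => hmeas _
  have hf0' : ∀ i ω, 0 ≤ f (θ i) ω := fun i ω => hnonneg _ _
  obtain ⟨φ, hφ, htail, horth⟩ := exists_strictMono_of_eventually
    (fun n a => (eventually_abs_integral_mul_le hf' hf0' hh hh0 hhle hweakμ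
        (show (0 : ℝ) < (1 / 4) ^ n by positivity) (n + 1) a).and
      (eventually_abs_integral_mul_le hf' hf0' hh hh0 hhle hweakν
        (show (0 : ℝ) < (1 / 4) ^ n by positivity) (n + 1) a))
    (fun n => eventually_integral_min_sub_min_le hf' hf0' hh hh0 hhle hweakν
      (show (0 : ℝ) < (1 / 2) ^ n by positivity) n)
  refine ⟨F, hFm, θ ∘ φ, hθ.comp hφ, fun ψ hψ π hπ => ?_⟩
  have hσ : Function.Injective (ψ ∘ π) := hψ.injective.comp hπ.injective
  have hinf := ae_tendsto_atTop_of_tendsto_atTop (ν := μ) (g := fun n => f (θ (φ n)))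
    (fun n => hmeas _) (fun n ω => hnonneg _ _) hh hh0 hhle
    (fun a b hab => (horth a b hab).1) hσ
  have hfin := ae_tendsto_of_memLp_two (ν := ν) (g := fun n => f (θ (φ n)))
    (fun n => hmeas _) (fun n ω => hnonneg _ _) hh hh0 hhle hmono hG
    (hνae.2 (Eventually.of_forall hFfin))
    (fun a b hab => (horth a b hab).2) htail hσ
  filter_upwards [hinf, hνae.1 hfin] with ω h1 h2
  by_cases hω : F ω = ⊤
  · rw [hω]
    exact ENNReal.tendsto_ofReal_nhds_top.2 (h1 (hFtop ω hω))
  · have h3 := ENNReal.tendsto_ofReal (h2 hω)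
    rw [ENNReal.ofReal_toReal hω] at h3
    exact h3
end

section
/- Let (Ω, Σ, μ) be a probability space and (f_n)_{n≥1} a sequence of real-valued integrable functions on Ω with sup_n ∫ |f_n| dμ < ∞. Then there exist f ∈ L¹(μ) and a strictly increasing map φ : ℕ → ℕ such that, setting g_n = f_{φ(n)}, for every strictly increasing map ψ : ℕ → ℕ and every bijection π : ℕ → ℕ, the Cesàro means (1/n) ∑_{k=1}^n g_{ψ(π(k))}(ω) converge to f(ω) for μ-almost every ω ∈ Ω. -/
open MeasureTheory Filter Topology

theorem sum_min_sq_div_sq_le {x : ℝ} (hx : 0 ≤ x) (N : ℕ) :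
    ∑ k ∈ Finset.range N, (min x (k + 1)) ^ 2 / ((k : ℝ) + 1) ^ 2 ≤ 4 * x := by
  rcases hx.eq_or_lt with rfl | hx
  · have : ∀ k : ℕ, min (0 : ℝ) (k + 1) = 0 := fun k => min_eq_left (by positivity)
    simp [this]
  suffices h : ∑ k ∈ Finset.range N, (min x (k + 1)) ^ 2 / ((k : ℝ) + 1) ^ 2
      ≤ 4 * x - 4 * x ^ 2 / (x + N) from h.trans (sub_le_self _ (by positivity))
  induction N with
  | zero => simp; field_simp; simp
  | succ N ih =>
    rw [Finset.sum_range_succ]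
    have h1 : (min x ((N : ℝ) + 1)) ^ 2 / ((N : ℝ) + 1) ^ 2
        ≤ 4 * x ^ 2 / (x + N) - 4 * x ^ 2 / (x + (N + 1)) := by
      have e : 4 * x ^ 2 / (x + N) - 4 * x ^ 2 / (x + (N + 1))
          = 4 * x ^ 2 / ((x + N) * (x + (N + 1))) := by field_simp; ring
      have hN : (0 : ℝ) ≤ N := N.cast_nonneg
      rw [e, div_le_div_iff₀ (by positivity) (by positivity)]
      have h2 : min x ((N : ℝ) + 1) * (x + (N + 1)) ≤ 2 * (x * (N + 1)) := by
        rcases le_total x ((N : ℝ) + 1) with h | h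
        · rw [min_eq_left h]; nlinarith
        · rw [min_eq_right h]; nlinarith
      have h0 : 0 ≤ min x ((N : ℝ) + 1) := le_min hx.le (by positivity)
      calc _ ≤ (min x ((N : ℝ) + 1)) ^ 2 * ((x + (N + 1)) * (x + (N + 1))) := by gcongr; linarith
        _ = (min x ((N : ℝ) + 1) * (x + (N + 1))) ^ 2 := by ring
        _ ≤ (2 * (x * (N + 1))) ^ 2 := by gcongr
        _ = _ := by ring
    push_cast
    linarith

/-- Inductive choice of a sequence whose pairs `(m, φ m)` satisfy a family of conditions, each of
which holds eventually along `l` once the earlier terms are fixed. -/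
theorem exists_seq_of_eventually {l : Filter ℕ} [l.NeBot] {Q : ℕ → ℕ → Prop}
    {R : ℕ → ℕ → ℕ → ℕ → Prop} (hQ : ∀ m, ∀ᶠ n in l, Q m n)
    (hR : ∀ m n' m', ∀ᶠ n in l, R m n' m' n) :
    ∃ φ : ℕ → ℕ, (∀ m, Q m (φ m)) ∧ ∀ m m', m < m' → R m (φ m) m' (φ m') := by
  have key : ∀ m' (ψ : ℕ → ℕ), ∃ n, Q m' n ∧ ∀ m < m', R m (ψ m) m' n := by
    intro m' ψ
    have h : ∀ᶠ n in l, ∀ m ∈ Finset.range m', R m (ψ m) m' n :=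
      (Finset.eventually_all _).2 fun m _ => hR m (ψ m) m'
    obtain ⟨n, h1, h2⟩ := ((hQ m').and h).exists
    exact ⟨n, h1, fun m hm => h2 m (Finset.mem_range.2 hm)⟩
  choose next hnext using key
  let φ : ℕ → ℕ := fun n => Nat.strongRec (motive := fun _ => ℕ)
    (fun m' ih => next m' fun m => if h : m < m' then ih m h else 0) n
  have hφ : ∀ n, φ n = next n fun m => if m < n then φ m else 0 := by
    intro n
    simp only [φ]
    rw [Nat.strongRec]
    simp
  refine ⟨φ, fun m => ?_, fun m m' hm => ?_⟩
  · rw [hφ]; exact (hnext _ _).1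
  · have := (hnext m' fun m => if m < m' then φ m else 0).2 m hm
    rw [hφ m']
    simpa [hm] using this

section

variable {Ω : Type*} [MeasurableSpace Ω] {μ : Measure Ω}

theorem setIntegral_eq_integral_mul_indicator {s : Set Ω} (hs : MeasurableSet s) (g : Ω → ℝ) :
    ∫ ω in s, g ω ∂μ = ∫ ω, g ω * s.indicator (fun _ => 1) ω ∂μ := by
  rw [← integral_indicator hs]
  congr 1 with ω
  by_cases h : ω ∈ s <;> simp [h]

/-- A uniformly bounded sequence of nonnegative measurable functions converges weakly in `L²` along
any ultrafilter. -/
theorem exists_weak_limit_of_bounded [IsProbabilityMeasure μ] (𝒰 : Ultrafilter ℕ)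
    {x : ℕ → Ω → ℝ} {B : ℝ} (hB : 0 ≤ B) (hm : ∀ n, Measurable (x n))
    (hx : ∀ n ω, x n ω ∈ Set.Icc 0 B) :
    ∃ h : Ω → ℝ, Measurable h ∧ (∀ ω, h ω ∈ Set.Icc 0 B) ∧
      ∀ y : Ω → ℝ, MemLp y 2 μ →
        Tendsto (fun n => ∫ ω, x n ω * y ω ∂μ) 𝒰 (𝓝 (∫ ω, h ω * y ω ∂μ)) := by
  have hxB : ∀ n ω, ‖x n ω‖ ≤ B := fun n ω => by
    rw [Real.norm_of_nonneg (hx n ω).1]; exact (hx n ω).2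
  have hxL : ∀ n, MemLp (x n) 2 μ := fun n =>
    MemLp.of_bound (hm n).aestronglyMeasurable B (ae_of_all _ (hxB n))
  let T : ℕ → WeakDual ℝ (Lp ℝ 2 μ) := fun n =>
    StrongDual.toWeakDual (InnerProductSpace.toDual ℝ _ ((hxL n).toLp (x n)))
  have hT : ∀ n, T n ∈ WeakDual.toStrongDual ⁻¹'
      Metric.closedBall (0 : StrongDual ℝ (Lp ℝ 2 μ)) B := by
    intro n
    simp only [Set.mem_preimage, mem_closedBall_zero_iff]
    change ‖InnerProductSpace.toDual ℝ _ ((hxL n).toLp (x n))‖ ≤ B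
    rw [LinearIsometryEquiv.norm_map, Lp.norm_toLp]
    refine ENNReal.toReal_le_of_le_ofReal hB ?_
    simpa using eLpNorm_le_of_ae_bound (p := 2) (ae_of_all μ (hxB n))
  obtain ⟨ℓ, -, hℓ⟩ := (WeakDual.isCompact_closedBall
    (0 : StrongDual ℝ (Lp ℝ 2 μ)) B).ultrafilter_le_nhds (𝒰.map T) (by
      rw [le_principal_iff]
      exact Filter.mem_map.2 (Filter.univ_mem' hT))
  let h₀ : Lp ℝ 2 μ := (InnerProductSpace.toDual ℝ _).symm (WeakDual.toStrongDual ℓ)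
  have lim₀ : ∀ y : Ω → ℝ, MemLp y 2 μ →
        Tendsto (fun n => ∫ ω, x n ω * y ω ∂μ) 𝒰 (𝓝 (∫ ω, h₀ ω * y ω ∂μ)) := by
    intro y hy
    have h1 : Tendsto (fun n => T n (hy.toLp y)) 𝒰 (𝓝 (ℓ (hy.toLp y))) :=
      ((WeakDual.eval_continuous (hy.toLp y)).tendsto ℓ).comp hℓ
    have h2 : ℓ (hy.toLp y) = ∫ ω, h₀ ω * y ω ∂μ := by
      have : ℓ (hy.toLp y) = inner ℝ h₀ (hy.toLp y) := by
        rw [InnerProductSpace.toDual_symm_apply]; rfl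
      rw [this, L2.inner_def]
      refine integral_congr_ae ?_
      filter_upwards [hy.coeFn_toLp] with ω hω
      simp [hω, mul_comm]
    rw [← h2]
    refine h1.congr fun n => ?_
    change inner ℝ ((hxL n).toLp (x n)) (hy.toLp y) = _
    rw [L2.inner_def]
    refine integral_congr_ae ?_
    filter_upwards [hy.coeFn_toLp, (hxL n).coeFn_toLp] with ω hω hω'
    simp [hω, hω', mul_comm]
  have hint₀ : Integrable h₀ μ := (Lp.memLp h₀).integrable (by norm_num)
  have limset : ∀ s, MeasurableSet s →
      Tendsto (fun n => ∫ ω in s, x n ω ∂μ) 𝒰 (𝓝 (∫ ω in s, h₀ ω ∂μ)) := by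
    intro s hs
    simp only [setIntegral_eq_integral_mul_indicator hs]
    exact lim₀ (s.indicator fun _ => 1) (MemLp.indicator hs (memLp_const 1))
  have hxint : ∀ n, Integrable (x n) μ := fun n => (hxL n).integrable (by norm_num)
  have hnn : ∀ᵐ ω ∂μ, 0 ≤ h₀ ω := by
    refine ae_nonneg_of_forall_setIntegral_nonneg hint₀ fun s hs _ => ?_
    exact ge_of_tendsto' (limset s hs) fun n => integral_nonneg fun ω => (hx n ω).1
  have hle : ∀ᵐ ω ∂μ, h₀ ω ≤ B := by
    refine ae_le_of_forall_setIntegral_le hint₀ (integrable_const B) fun s hs _ => ?_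
    exact le_of_tendsto' (limset s hs) fun n =>
      integral_mono (hxint n).integrableOn (integrable_const B) fun ω => (hx n ω).2
  refine ⟨fun ω => max 0 (min B (h₀ ω)), ?_, fun ω => ?_, fun y hy => ?_⟩
  · exact measurable_const.max (measurable_const.min (Lp.stronglyMeasurable h₀).measurable)
  · exact ⟨le_max_left _ _, max_le hB (min_le_left _ _)⟩
  · convert lim₀ y hy using 2
    refine integral_congr_ae ?_
    filter_upwards [hnn, hle] with ω h1 h2
    rw [min_eq_right h2, max_eq_right h1]

/-- Monotone convergence for an `L¹`-bounded sequence that increases almost everywhere. -/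
theorem exists_integrable_limit_of_monotone {h : ℕ → Ω → ℝ} (hm : ∀ a, Measurable (h a))
    (h0 : ∀ a ω, 0 ≤ h a ω) (hi : ∀ a, Integrable (h a) μ) {C : ℝ} (hC : ∀ a, ∫ ω, h a ω ∂μ ≤ C)
    (hmono : ∀ a, h a ≤ᵐ[μ] h (a + 1)) :
    ∃ F : Ω → ℝ, Integrable F μ ∧ ∀ᵐ ω ∂μ, Tendsto (fun a => h a ω) atTop (𝓝 (F ω)) := by
  let G : Ω → ENNReal := fun ω => ⨆ a, ENNReal.ofReal (h a ω)
  have hGm : Measurable G := Measurable.iSup fun a => (hm a).ennreal_ofReal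
  have hmono' : ∀ᵐ ω ∂μ, Monotone fun a => h a ω := by
    filter_upwards [ae_all_iff.2 hmono] with ω hω
    exact monotone_nat_of_le_succ hω
  have hG : ∫⁻ ω, G ω ∂μ ≠ ⊤ := by
    have : ∫⁻ ω, G ω ∂μ = ⨆ a, ∫⁻ ω, ENNReal.ofReal (h a ω) ∂μ := by
      refine lintegral_iSup' (fun a => (hm a).ennreal_ofReal.aemeasurable) ?_
      filter_upwards [hmono'] with ω hω a b hab
      exact ENNReal.ofReal_le_ofReal (hω hab)
    rw [this]
    refine ne_top_of_le_ne_top (ENNReal.ofReal_ne_top (r := C)) (iSup_le fun a => ?_)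
    rw [← ofReal_integral_eq_lintegral_ofReal (hi a) (ae_of_all _ (h0 a))]
    exact ENNReal.ofReal_le_ofReal (hC a)
  refine ⟨fun ω => (G ω).toReal, integrable_toReal_of_lintegral_ne_top hGm.aemeasurable hG, ?_⟩
  filter_upwards [hmono', ae_lt_top hGm hG] with ω h1 h2
  have := (ENNReal.tendsto_toReal h2.ne).comp
    (tendsto_atTop_iSup (f := fun a => ENNReal.ofReal (h a ω))
      fun a b hab => ENNReal.ofReal_le_ofReal (h1 hab))
  refine this.congr fun a => ?_
  simp [h0 a ω]

/-- The second moment argument of Etemadi: a variance bound forces the Cesàro means to vanish along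
the geometric sequence `⌊c ^ i⌋₊`. -/
theorem ae_tendsto_div_floor_pow {Z : ℕ → Ω → ℝ} {s : ℕ → ℝ} (hZ : ∀ k, MemLp (Z k) 2 μ)
    (hs0 : ∀ k, 0 ≤ s k) (hs : Summable fun k : ℕ => s k / ((k : ℝ) + 1) ^ 2)
    (hvar : ∀ n, 0 < n → ∫ ω, (∑ k ∈ Finset.range n, Z k ω) ^ 2 ∂μ ≤ ∑ k ∈ Finset.range n, s k)
    {c : ℝ} (hc : 1 < c) :
    ∀ᵐ ω ∂μ, Tendsto (fun i : ℕ => (∑ k ∈ Finset.range ⌊c ^ i⌋₊, Z k ω) / ⌊c ^ i⌋₊)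
      atTop (𝓝 0) := by
  set N : ℕ → ℕ := fun i => ⌊c ^ i⌋₊
  have hNpos : ∀ i, 0 < N i := fun i => Nat.floor_pos.2 (one_le_pow₀ hc.le)
  set K : ℝ := c ^ 5 * (c - 1)⁻¹ ^ 3
  have hK0 : 0 ≤ K := by
    have : 0 < c - 1 := sub_pos.2 hc
    positivity
  set D : ℕ → Ω → ℝ := fun i ω => ((∑ k ∈ Finset.range (N i), Z k ω) / N i) ^ 2 with hD
  have hDL : ∀ n, MemLp (fun ω => ∑ k ∈ Finset.range n, Z k ω) 2 μ := fun n =>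
    memLp_finsetSum _ fun k _ => hZ k
  have hDi : ∀ i, Integrable (D i) μ := fun i => by
    simp only [hD, div_pow]
    exact (hDL (N i)).integrable_sq.div_const _
  have hDbound : ∀ i, ∫ ω, D i ω ∂μ ≤ ∑ k ∈ Finset.range (N i), s k * (1 / (N i : ℝ) ^ 2) := by
    intro i
    simp only [hD, div_pow]
    rw [integral_div, ← Finset.sum_mul, mul_one_div]
    gcongr
    exact hvar _ (hNpos i)
  have hpart : ∀ M, ∑ i ∈ Finset.range M, ∫ ω, D i ω ∂μ
      ≤ 4 * K * ∑' k : ℕ, s k / ((k : ℝ) + 1) ^ 2 := by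
    intro M
    obtain ⟨L, hL⟩ : ∃ L, ∀ i ∈ Finset.range M, N i ≤ L :=
      ⟨(Finset.range M).sup N, fun i hi => Finset.le_sup hi⟩
    calc ∑ i ∈ Finset.range M, ∫ ω, D i ω ∂μ
        ≤ ∑ i ∈ Finset.range M, ∑ k ∈ Finset.range L,
            if ((k : ℝ) + 1) / 2 < N i then s k * (1 / (N i : ℝ) ^ 2) else 0 := by
          refine Finset.sum_le_sum fun i hi => (hDbound i).trans ?_
          rw [← Finset.sum_filter]
          refine Finset.sum_le_sum_of_subset_of_nonneg (fun k hk => ?_) fun k _ _ =>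
            mul_nonneg (hs0 k) (by positivity)
          have hk' : k < N i := Finset.mem_range.1 hk
          have : (k : ℝ) + 1 ≤ N i := by exact_mod_cast hk'
          have hk0 : (0 : ℝ) ≤ k := k.cast_nonneg
          exact Finset.mem_filter.2 ⟨Finset.mem_range.2 (hk'.trans_le (hL i hi)), by linarith⟩
      _ = ∑ k ∈ Finset.range L, s k *
            ∑ i ∈ Finset.range M with ((k : ℝ) + 1) / 2 < N i, 1 / (N i : ℝ) ^ 2 := by
          rw [Finset.sum_comm]
          refine Finset.sum_congr rfl fun k _ => ?_
          rw [← Finset.sum_filter, Finset.mul_sum]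
      _ ≤ ∑ k ∈ Finset.range L, s k * (K / (((k : ℝ) + 1) / 2) ^ 2) := by
          refine Finset.sum_le_sum fun k _ => mul_le_mul_of_nonneg_left ?_ (hs0 k)
          exact sum_div_nat_floor_pow_sq_le_div_sq M (by positivity) hc
      _ = 4 * K * ∑ k ∈ Finset.range L, s k / ((k : ℝ) + 1) ^ 2 := by
          rw [Finset.mul_sum]
          refine Finset.sum_congr rfl fun k _ => ?_
          field_simp
          norm_num
      _ ≤ _ := by
          gcongr
          exact hs.sum_le_tsum _ fun k _ => div_nonneg (hs0 k) (by positivity)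
  have hD0 : ∀ i ω, 0 ≤ D i ω := fun i ω => sq_nonneg _
  have hsum : Summable fun i => ∫ ω, D i ω ∂μ :=
    summable_of_sum_range_le (fun i => integral_nonneg (hD0 i)) hpart
  have htop : ∫⁻ ω, ∑' i, ENNReal.ofReal (D i ω) ∂μ ≠ ⊤ := by
    rw [lintegral_tsum fun i => (hDi i).1.aemeasurable.ennreal_ofReal]
    simp_rw [← ofReal_integral_eq_lintegral_ofReal (hDi _) (ae_of_all _ (hD0 _))]
    rw [← ENNReal.ofReal_tsum_of_nonneg (fun i => integral_nonneg (hD0 i)) hsum]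
    exact ENNReal.ofReal_ne_top
  filter_upwards [ae_lt_top' (AEMeasurable.tsum
    fun i => (hDi i).1.aemeasurable.ennreal_ofReal) htop] with ω hω
  have h1 := ENNReal.tendsto_atTop_zero_of_tsum_ne_top hω.ne
  have h2 : Tendsto (fun i => D i ω) atTop (𝓝 0) := by
    have := (ENNReal.tendsto_toReal ENNReal.zero_ne_top).comp h1
    simpa [Function.comp_def, hD0, ENNReal.toReal_ofReal] using this
  have h3 := h2.sqrt
  simp only [hD, Real.sqrt_sq_eq_abs, Real.sqrt_zero] at h3
  exact (tendsto_zero_iff_abs_tendsto_zero _).2 h3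

theorem exists_tendsto_ultrafilter_of_mem_Icc (𝒰 : Ultrafilter ℕ) {u : ℕ → ℝ} {a b : ℝ}
    (hu : ∀ n, u n ∈ Set.Icc a b) : ∃ l, Tendsto u 𝒰 (𝓝 l) := by
  obtain ⟨l, -, hl⟩ := (isCompact_Icc (a := a) (b := b)).ultrafilter_le_nhds (𝒰.map u)
    (le_principal_iff.2 (Filter.mem_map.2 (Filter.univ_mem' hu)))
  exact ⟨l, hl⟩

/-- A subsequence whose truncations have almost uncorrelated deviations from their weak limits
`h a`, together with uniform second moment bounds at all levels `a ≤ 2 ^ m`. -/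
theorem exists_truncation_limits [IsProbabilityMeasure μ] {f : ℕ → Ω → ℝ}
    (hm : ∀ n, Measurable (f n)) (h0 : ∀ n ω, 0 ≤ f n ω) (hint : ∀ n, Integrable (f n) μ)
    {C : ℝ} (hC : ∀ n, ∫ ω, f n ω ∂μ ≤ C) :
    ∃ (h : ℕ → Ω → ℝ) (F : Ω → ℝ) (q : ℕ → ℝ) (φ : ℕ → ℕ),
      (∀ a, Measurable (h a)) ∧ (∀ (a : ℕ) ω, h a ω ∈ Set.Icc 0 (a : ℝ)) ∧
      Integrable F μ ∧ (∀ᵐ ω ∂μ, Tendsto (fun a => h a ω) atTop (𝓝 (F ω))) ∧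
      (∀ a, 0 ≤ q a) ∧ Monotone q ∧ (Summable fun k : ℕ => q (k + 1) / ((k : ℝ) + 1) ^ 2) ∧
      StrictMono φ ∧
      (∀ m (a : ℕ), a ≤ 2 ^ m → ∫ ω, (min (f (φ m) ω) a) ^ 2 ∂μ ≤ q a + 1 ∧
        ∫ ω, (min (f (φ m) ω) a - h a ω) ^ 2 ∂μ ≤ q a + 1) ∧
      (∀ m m', m < m' → ∀ a : ℕ, a ≤ 2 ^ m → ∀ b : ℕ, b ≤ 2 ^ m' →
        |∫ ω, (min (f (φ m) ω) a - h a ω) * (min (f (φ m') ω) b - h b ω) ∂μ|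
          ≤ (1 / 2) ^ m * (1 / 2) ^ m') := by
  let 𝒰 : Ultrafilter ℕ := hyperfilter ℕ
  have hx : ∀ (a n : ℕ) ω, min (f n ω) a ∈ Set.Icc 0 (a : ℝ) := fun a n ω =>
    ⟨le_min (h0 n ω) a.cast_nonneg, min_le_right _ _⟩
  have hxm : ∀ a n : ℕ, Measurable fun ω => min (f n ω) (a : ℝ) := fun a n =>
    (hm n).min measurable_const
  have memLp_of_Icc : ∀ (a : ℕ) (g : Ω → ℝ), Measurable g → (∀ ω, g ω ∈ Set.Icc 0 (a : ℝ)) →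
      MemLp g 2 μ := fun a g hg h =>
    MemLp.of_bound hg.aestronglyMeasurable a (ae_of_all _ fun ω => by
      rw [Real.norm_of_nonneg (h ω).1]; exact (h ω).2)
  have hxL : ∀ a n : ℕ, MemLp (fun ω => min (f n ω) (a : ℝ)) 2 μ := fun a n =>
    memLp_of_Icc a _ (hxm a n) (hx a n)
  have hxi : ∀ a n : ℕ, Integrable (fun ω => min (f n ω) (a : ℝ)) μ := fun a n =>
    (hxL a n).integrable (by norm_num)
  choose h hhm hh hlim using fun a : ℕ =>
    exists_weak_limit_of_bounded (μ := μ) 𝒰 a.cast_nonneg (hxm a) (hx a)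
  have hhL : ∀ a, MemLp (h a) 2 μ := fun a => memLp_of_Icc a _ (hhm a) (hh a)
  have hhi : ∀ a, Integrable (h a) μ := fun a => (hhL a).integrable (by norm_num)
  have hmono : ∀ a, h a ≤ᵐ[μ] h (a + 1) := by
    intro a
    refine ae_le_of_forall_setIntegral_le (hhi a) (hhi (a + 1)) fun s hs _ => ?_
    have hind : MemLp (s.indicator fun _ => (1 : ℝ)) 2 μ := MemLp.indicator hs (memLp_const 1)
    rw [setIntegral_eq_integral_mul_indicator hs, setIntegral_eq_integral_mul_indicator hs]
    refine le_of_tendsto_of_tendsto' (hlim a _ hind) (hlim (a + 1) _ hind) fun n => ?_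
    rw [← setIntegral_eq_integral_mul_indicator hs, ← setIntegral_eq_integral_mul_indicator hs]
    refine integral_mono (hxi a n).integrableOn (hxi (a + 1) n).integrableOn fun ω => ?_
    exact min_le_min_left _ (by push_cast; linarith)
  have hhC : ∀ a, ∫ ω, h a ω ∂μ ≤ C := by
    intro a
    have := hlim a (fun _ => 1) (memLp_const 1)
    simp only [mul_one] at this
    exact le_of_tendsto' this fun n =>
      (integral_mono (hxi a n) (hint n) fun ω => min_le_left _ _).trans (hC n)
  obtain ⟨F, hFi, hF⟩ :=
    exists_integrable_limit_of_monotone hhm (fun a ω => (hh a ω).1) hhi hhC hmono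
  have hsqi : ∀ a n : ℕ, Integrable (fun ω => (min (f n ω) (a : ℝ)) ^ 2) μ := fun a n =>
    (hxL a n).integrable_sq
  choose q hq using fun a : ℕ => exists_tendsto_ultrafilter_of_mem_Icc 𝒰
    (u := fun n => ∫ ω, (min (f n ω) (a : ℝ)) ^ 2 ∂μ) (a := 0) (b := (a : ℝ) ^ 2) fun n => by
      refine ⟨integral_nonneg fun ω => sq_nonneg _, ?_⟩
      have := integral_mono (hsqi a n) (integrable_const ((a : ℝ) ^ 2))
        fun ω => pow_le_pow_left₀ (hx a n ω).1 (hx a n ω).2 2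
      simpa using this
  have hq0 : ∀ a, 0 ≤ q a := fun a =>
    ge_of_tendsto' (hq a) fun n => integral_nonneg fun ω => sq_nonneg _
  have hqmono : Monotone q := fun a b hab =>
    le_of_tendsto_of_tendsto' (hq a) (hq b) fun n =>
      integral_mono (hsqi a n) (hsqi b n) fun ω =>
        pow_le_pow_left₀ (hx a n ω).1 (min_le_min_left _ (by exact_mod_cast hab)) 2
  have hqsum : Summable fun k : ℕ => q (k + 1) / ((k : ℝ) + 1) ^ 2 := by
    refine summable_of_sum_range_le (c := 4 * C)
      (fun k => div_nonneg (hq0 _) (by positivity)) fun N => ?_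
    refine le_of_tendsto' (tendsto_finsetSum _ fun k _ => (hq (k + 1)).div_const _) fun n => ?_
    simp_rw [← integral_div]
    rw [← integral_finsetSum _ fun k _ => (hsqi (k + 1) n).div_const _]
    calc _ ≤ ∫ ω, 4 * f n ω ∂μ := by
          refine integral_mono (integrable_finsetSum _ fun k _ => (hsqi (k + 1) n).div_const _)
            ((hint n).const_mul 4) fun ω => ?_
          simpa using sum_min_sq_div_sq_le (h0 n ω) N
      _ ≤ 4 * C := by rw [integral_const_mul]; linarith [hC n]
  have hdL : ∀ a n : ℕ, MemLp (fun ω => min (f n ω) (a : ℝ) - h a ω) 2 μ := fun a n =>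
    (hxL a n).sub (hhL a)
  have hdev : ∀ a : ℕ, Tendsto (fun n => ∫ ω, (min (f n ω) (a : ℝ) - h a ω) ^ 2 ∂μ) 𝒰
      (𝓝 (q a - ∫ ω, h a ω * h a ω ∂μ)) := by
    intro a
    have h1 := ((hq a).sub ((hlim a _ (hhL a)).const_mul 2)).add_const (∫ ω, h a ω * h a ω ∂μ)
    have e : q a - ∫ ω, h a ω * h a ω ∂μ
        = q a - 2 * ∫ ω, h a ω * h a ω ∂μ + ∫ ω, h a ω * h a ω ∂μ := by ring
    rw [e]
    refine h1.congr fun n => ?_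
    have i1 : Integrable (fun ω => min (f n ω) (a : ℝ) * h a ω) μ :=
      (hxL a n).integrable_mul (hhL a)
    have i2 : Integrable (fun ω => h a ω * h a ω) μ := (hhL a).integrable_mul (hhL a)
    have i3 : Integrable (fun ω => min (f n ω) (a : ℝ) ^ 2 - 2 * (min (f n ω) (a : ℝ) * h a ω)) μ :=
      (hsqi a n).sub (i1.const_mul 2)
    rw [← integral_const_mul, ← integral_sub (hsqi a n) (i1.const_mul 2), ← integral_add i3 i2]
    congr 1 with ω
    ring
  have hcross : ∀ (a n b : ℕ), Tendsto
      (fun n' => ∫ ω, (min (f n ω) (a : ℝ) - h a ω) * (min (f n' ω) (b : ℝ) - h b ω) ∂μ)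
      𝒰 (𝓝 0) := by
    intro a n b
    have h1 := (hlim b _ (hdL a n)).sub_const (∫ ω, h b ω * (min (f n ω) (a : ℝ) - h a ω) ∂μ)
    rw [sub_self] at h1
    refine h1.congr fun n' => ?_
    have i1 : Integrable (fun ω => min (f n' ω) (b : ℝ) * (min (f n ω) (a : ℝ) - h a ω)) μ :=
      (hxL b n').integrable_mul (hdL a n)
    have i2 : Integrable (fun ω => h b ω * (min (f n ω) (a : ℝ) - h a ω)) μ :=
      (hhL b).integrable_mul (hdL a n)
    rw [← integral_sub i1 i2]
    congr 1 with ω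
    ring
  obtain ⟨φ, hφQ, hφR⟩ := exists_seq_of_eventually (l := (𝒰 : Filter ℕ))
    (Q := fun m n => ∀ a ∈ Finset.range (2 ^ m + 1), ∫ ω, (min (f n ω) (a : ℝ)) ^ 2 ∂μ ≤ q a + 1 ∧
        ∫ ω, (min (f n ω) (a : ℝ) - h a ω) ^ 2 ∂μ ≤ q a + 1)
    (R := fun m n m' n' => n < n' ∧ ∀ a ∈ Finset.range (2 ^ m + 1),
      ∀ b ∈ Finset.range (2 ^ m' + 1),
        |∫ ω, (min (f n ω) (a : ℝ) - h a ω) * (min (f n' ω) (b : ℝ) - h b ω) ∂μ|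
          ≤ (1 / 2) ^ m * (1 / 2) ^ m')
    (by
      intro m
      refine (Finset.eventually_all _).2 fun a _ => ?_
      have hpos : 0 ≤ ∫ ω, h a ω * h a ω ∂μ := integral_nonneg fun ω => mul_self_nonneg _
      exact ((hq a).eventually_le_const (by linarith)).and
        ((hdev a).eventually_le_const (by linarith)))
    (by
      intro m n m'
      refine ((eventually_gt_atTop n).filter_mono Nat.hyperfilter_le_atTop).and ?_
      refine (Finset.eventually_all _).2 fun a _ => (Finset.eventually_all _).2 fun b _ => ?_
      have := (hcross a n b).abs
      rw [abs_zero] at this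
      exact this.eventually_le_const (by positivity))
  refine ⟨h, F, q, φ, hhm, hh, hFi, hF, hq0, hqmono, hqsum,
    fun m m' hmm => (hφR m m' hmm).1, fun m a ha => hφQ m a ?_, fun m m' hmm a ha b hb =>
      (hφR m m' hmm).2 a ?_ b ?_⟩ <;> exact Finset.mem_range.2 (Nat.lt_succ_of_le ‹_›)

/-- Komlós theorem for nonnegative functions, for arbitrary injective rearrangements. -/
theorem exists_subseq_forall_injective_cesaro_tendsto_of_nonneg [IsProbabilityMeasure μ]
    {f : ℕ → Ω → ℝ} (hm : ∀ n, Measurable (f n)) (h0 : ∀ n ω, 0 ≤ f n ω)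
    (hint : ∀ n, Integrable (f n) μ) {C : ℝ} (hC : ∀ n, ∫ ω, f n ω ∂μ ≤ C) :
    ∃ F : Ω → ℝ, Integrable F μ ∧ ∃ φ : ℕ → ℕ, StrictMono φ ∧
      ∀ σ : ℕ → ℕ, Function.Injective σ → ∀ᵐ ω ∂μ,
        Tendsto (fun n : ℕ => (∑ k ∈ Finset.range n, f (φ (σ k)) ω) / n) atTop (𝓝 (F ω)) := by
  obtain ⟨h, F, q, φ, hhm, hh, hFi, hF, hq0, hqmono, hqsum, hφ, hsq, hcross⟩ :=
    exists_truncation_limits hm h0 hint hC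
  refine ⟨F, hFi, φ, hφ, fun σ hσ => ?_⟩
  have hC0 : 0 ≤ C := (integral_nonneg (h0 0)).trans (hC 0)
  set w : ℕ → ℝ := fun k => (1 / 2) ^ σ k with hw
  have hw0 : ∀ k, 0 ≤ w k := fun k => by positivity
  have hwsum : Summable w := summable_geometric_two.comp_injective hσ
  have hw2 : ∀ n, ∑ k ∈ Finset.range n, w k ≤ 2 := by
    intro n
    rw [← tsum_geometric_two, ← Finset.sum_image (f := fun m => (1 / 2 : ℝ) ^ m) hσ.injOn]
    exact summable_geometric_two.sum_le_tsum _ fun m _ => by positivity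
  set lv : ℕ → ℕ := fun k => min (k + 1) (2 ^ σ k)
  have hlv2 : ∀ k, lv k ≤ 2 ^ σ k := fun k => min_le_right _ _
  have hlvk : ∀ k, lv k ≤ k + 1 := fun k => min_le_left _ _
  have hlvtop : Tendsto lv atTop atTop := by
    refine tendsto_atTop.2 fun b => ?_
    filter_upwards [eventually_ge_atTop b, hσ.nat_tendsto_atTop.eventually_ge_atTop b] with k h1 h2
    exact le_min (h1.trans k.le_succ) (h2.trans Nat.lt_two_pow_self.le)
  set t : ℕ → ℝ := fun k => q (k + 1) + 1 with ht
  have ht1 : ∀ k, 1 ≤ t k := fun k => by simpa [ht] using hq0 (k + 1)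
  have hqt : ∀ k, q (lv k) + 1 ≤ t k := fun k => by simpa [ht] using hqmono (hlvk k)
  have htsum : Summable fun k : ℕ => t k / ((k : ℝ) + 1) ^ 2 := by
    have h1 : Summable fun k : ℕ => 1 / ((k : ℝ) + 1) ^ 2 := by
      have := (summable_nat_add_iff 1).2 (Real.summable_one_div_nat_pow.2 one_lt_two)
      simpa using this
    simpa [ht, add_div] using hqsum.add h1
  set Y : ℕ → Ω → ℝ := fun k ω => min (f (φ (σ k)) ω) (lv k) with hY
  have hYm : ∀ k, Measurable (Y k) := fun k => (hm _).min measurable_const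
  have hY0 : ∀ k ω, 0 ≤ Y k ω := fun k ω => le_min (h0 _ ω) (Nat.cast_nonneg _)
  have hYL : ∀ k, MemLp (Y k) 2 μ := fun k =>
    MemLp.of_bound (hYm k).aestronglyMeasurable (lv k) (ae_of_all _ fun ω => by
      rw [Real.norm_of_nonneg (hY0 k ω)]; exact min_le_right _ _)
  set Z : ℕ → Ω → ℝ := fun k ω => Y k ω - h (lv k) ω with hZ
  have hZL : ∀ k, MemLp (Z k) 2 μ := fun k =>
    (hYL k).sub (MemLp.of_bound (hhm _).aestronglyMeasurable (lv k) (ae_of_all _ fun ω => by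
      rw [Real.norm_of_nonneg (hh _ ω).1]; exact (hh _ ω).2))
  have hZZ : ∀ j k, ∫ ω, Z j ω * Z k ω ∂μ ≤ (if j = k then t k else 0) + w j * w k := by
    intro j k
    rcases eq_or_ne j k with rfl | hjk
    · have := (hsq (σ j) (lv j) (hlv2 j)).2.trans (hqt j)
      simp only [if_true, ← sq]
      simp only [hZ, hY]
      linarith [sq_nonneg (w j)]
    · rw [if_neg hjk, zero_add]
      rcases lt_or_gt_of_ne (hσ.ne hjk) with hlt | hlt
      · exact (le_abs_self _).trans (hcross _ _ hlt _ (hlv2 j) _ (hlv2 k))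
      · have := (le_abs_self _).trans (hcross _ _ hlt _ (hlv2 k) _ (hlv2 j))
        simp_rw [mul_comm (Z j _), mul_comm (w j)]
        exact this
  have hvar : ∀ n, 0 < n → ∫ ω, (∑ k ∈ Finset.range n, Z k ω) ^ 2 ∂μ
      ≤ ∑ k ∈ Finset.range n, 5 * t k := by
    intro n hn
    have hi : ∀ j k, Integrable (fun ω => Z j ω * Z k ω) μ := fun j k =>
      (hZL j).integrable_mul (hZL k)
    have htn : 1 ≤ ∑ k ∈ Finset.range n, t k :=
      (ht1 0).trans (Finset.single_le_sum (f := t) (fun k _ => zero_le_one.trans (ht1 k))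
        (Finset.mem_range.2 hn))
    have hwn : (∑ k ∈ Finset.range n, w k) ^ 2 ≤ 2 ^ 2 :=
      pow_le_pow_left₀ (Finset.sum_nonneg fun k _ => hw0 k) (hw2 n) 2
    calc ∫ ω, (∑ k ∈ Finset.range n, Z k ω) ^ 2 ∂μ
        = ∑ j ∈ Finset.range n, ∑ k ∈ Finset.range n, ∫ ω, Z j ω * Z k ω ∂μ := by
          simp_rw [sq, Finset.sum_mul_sum]
          rw [integral_finsetSum _ fun j _ => integrable_finsetSum _ fun k _ => hi j k]
          exact Finset.sum_congr rfl fun j _ => integral_finsetSum _ fun k _ => hi j k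
      _ ≤ ∑ j ∈ Finset.range n, ∑ k ∈ Finset.range n, ((if j = k then t k else 0) + w j * w k) :=
          Finset.sum_le_sum fun j _ => Finset.sum_le_sum fun k _ => hZZ j k
      _ = ∑ k ∈ Finset.range n, t k + (∑ k ∈ Finset.range n, w k) ^ 2 := by
          simp_rw [Finset.sum_add_distrib, sq, Finset.sum_mul_sum]
          congr 1
          refine Finset.sum_congr rfl fun j hj => ?_
          rw [Finset.sum_ite_eq, if_pos hj]
      _ ≤ _ := by rw [← Finset.mul_sum]; linarith
  have hfloor : ∀ c : ℝ, 1 < c → ∀ᵐ ω ∂μ,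
      Tendsto (fun i : ℕ => (∑ k ∈ Finset.range ⌊c ^ i⌋₊, Z k ω) / ⌊c ^ i⌋₊) atTop (𝓝 0) :=
    fun c hc => ae_tendsto_div_floor_pow hZL (fun k => by linarith [ht1 k])
      (by simpa [mul_div_assoc] using htsum.mul_left 5) hvar hc
  have htail : ∀ k, μ {ω | (lv k : ℝ) ≤ f (φ (σ k)) ω}
      ≤ ENNReal.ofReal (C * w k + t k / ((k : ℝ) + 1) ^ 2) := by
    intro k
    rw [← ofReal_measureReal]
    refine ENNReal.ofReal_le_ofReal ?_
    have e1 : 0 ≤ C * w k := mul_nonneg hC0 (hw0 k)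
    have e2 : 0 ≤ t k / ((k : ℝ) + 1) ^ 2 := div_nonneg (zero_le_one.trans (ht1 k)) (by positivity)
    rcases min_choice (k + 1) (2 ^ σ k) with hk | hk
    · have hk' : lv k = k + 1 := hk
      refine le_trans ?_ (le_add_of_nonneg_left e1)
      rw [le_div_iff₀' (by positivity)]
      have h1 := mul_meas_ge_le_integral_of_nonneg (ae_of_all μ fun ω => sq_nonneg (Y k ω))
        (hYL k).integrable_sq (((k : ℝ) + 1) ^ 2)
      refine le_trans ?_ (h1.trans ((hsq (σ k) (lv k) (hlv2 k)).1.trans (hqt k)))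
      refine mul_le_mul_of_nonneg_left (measureReal_mono fun ω hω => ?_) (by positivity)
      have hω' : (lv k : ℝ) ≤ f (φ (σ k)) ω := hω
      change _ ≤ (min (f (φ (σ k)) ω) (lv k : ℝ)) ^ 2
      rw [min_eq_right hω', hk']
      push_cast
      exact le_rfl
    · have hk' : lv k = 2 ^ σ k := hk
      refine le_trans ?_ (le_add_of_nonneg_right e2)
      have h1 := (mul_meas_ge_le_integral_of_nonneg (ae_of_all μ (h0 (φ (σ k)))) (hint _)
        (2 ^ σ k)).trans (hC _)
      rw [hk']
      push_cast
      simp only [hw, one_div, inv_pow, ← div_eq_mul_inv]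
      rwa [le_div_iff₀' (by positivity)]
  have hBC : ∀ᵐ ω ∂μ, ∀ᶠ k in atTop, ω ∉ {ω | (lv k : ℝ) ≤ f (φ (σ k)) ω} := by
    refine ae_eventually_notMem (ne_top_of_le_ne_top ?_ (ENNReal.tsum_le_tsum htail))
    exact ((hwsum.mul_left C).add htsum).tsum_ofReal_ne_top
  have hc1 : ∀ i : ℕ, (1 : ℝ) < 1 + 1 / ((i : ℝ) + 1) := fun i =>
    lt_add_of_pos_right _ (by positivity)
  have hclim : Tendsto (fun i : ℕ => (1 : ℝ) + 1 / ((i : ℝ) + 1)) atTop (𝓝 1) := by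
    simpa using tendsto_one_div_add_atTop_nhds_zero_nat.const_add (1 : ℝ)
  filter_upwards [hF, hBC, ae_all_iff.2 fun i => hfloor _ (hc1 i)] with ω hFω hBCω hfl
  have hH : Tendsto (fun n : ℕ => (∑ k ∈ Finset.range n, h (lv k) ω) / n) atTop (𝓝 (F ω)) := by
    simpa [div_eq_inv_mul] using (hFω.comp hlvtop).cesaro
  have hYlim : Tendsto (fun n : ℕ => (∑ k ∈ Finset.range n, Y k ω) / n) atTop (𝓝 (F ω)) := by
    refine tendsto_div_of_monotone_of_tendsto_div_floor_pow
      (fun n => ∑ k ∈ Finset.range n, Y k ω) (F ω)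
      (monotone_nat_of_le_succ fun n => by simpa [Finset.sum_range_succ] using hY0 n ω)
      _ hc1 hclim fun i => ?_
    have hfloortop : Tendsto (fun n : ℕ => ⌊(1 + 1 / ((i : ℝ) + 1)) ^ n⌋₊) atTop atTop :=
      tendsto_nat_floor_atTop.comp (tendsto_pow_atTop_atTop_of_one_lt (hc1 i))
    have := (hfl i).add (hH.comp hfloortop)
    rw [zero_add] at this
    refine this.congr fun n => ?_
    simp [hZ, ← add_div]
  have hdiff : Tendsto (fun n : ℕ => (∑ k ∈ Finset.range n, (f (φ (σ k)) ω - Y k ω)) / n)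
      atTop (𝓝 0) := by
    have : Tendsto (fun k => f (φ (σ k)) ω - Y k ω) atTop (𝓝 0) := by
      refine tendsto_const_nhds.congr' ?_
      filter_upwards [hBCω] with k hk
      have hk' : f (φ (σ k)) ω < lv k := not_le.1 hk
      simp [hY, min_eq_left hk'.le]
    simpa [div_eq_inv_mul] using this.cesaro
  have := hdiff.add hYlim
  rw [zero_add] at this
  refine this.congr fun n => ?_
  simp [← add_div]

end

/-- Permutation-invariant Komlós theorem for real-valued functions:
every `L¹`-bounded sequence of integrable real functions has a subsequence `g`
such that the Cesàro means of every permuted subsequence of `g` converge a.e.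
to a fixed integrable function `F`. -/
theorem komlos_real_perm_invariant
    {Ω : Type*} [MeasurableSpace Ω] (μ : Measure Ω) [IsProbabilityMeasure μ]
    (f : ℕ → Ω → ℝ) (hint : ∀ n, Integrable (f n) μ)
    (hbd : ∃ C : ℝ, ∀ n, ∫ ω, |f n ω| ∂μ ≤ C) :
    ∃ (F : Ω → ℝ), Integrable F μ ∧ ∃ φ : ℕ → ℕ, StrictMono φ ∧
      ∀ ψ : ℕ → ℕ, StrictMono ψ → ∀ π : ℕ → ℕ, Function.Bijective π →
        ∀ᵐ ω ∂μ, Tendsto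
          (fun n : ℕ => (∑ k ∈ Finset.range n, f (φ (ψ (π k))) ω) / n)
          atTop (𝓝 (F ω)) := by
  obtain ⟨C, hC⟩ := hbd
  let g : ℕ → Ω → ℝ := fun n => (hint n).1.mk (f n)
  have hgm : ∀ n, Measurable (g n) := fun n => (hint n).1.stronglyMeasurable_mk.measurable
  have hfg : ∀ n, f n =ᵐ[μ] g n := fun n => (hint n).1.ae_eq_mk
  have hgi : ∀ n, Integrable (g n) μ := fun n => (hint n).congr (hfg n)
  have hgC : ∀ n, ∫ ω, |g n ω| ∂μ ≤ C := fun n => by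
    refine le_of_eq_of_le (integral_congr_ae ?_) (hC n)
    filter_upwards [hfg n] with ω hω
    rw [hω]
  have hpi : ∀ n, Integrable (fun ω => max (g n ω) 0) μ := fun n => (hgi n).pos_part
  have hni : ∀ n, Integrable (fun ω => max (-g n ω) 0) μ := fun n => (hgi n).neg_part
  obtain ⟨F₁, hF₁, φ₁, hφ₁, H₁⟩ := exists_subseq_forall_injective_cesaro_tendsto_of_nonneg
    (fun n => (hgm n).max measurable_const) (fun n ω => le_max_right (g n ω) 0) hpi (C := C)
    fun n => (integral_mono (hpi n) (hgi n).abs fun ω =>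
      max_le (le_abs_self (g n ω)) (abs_nonneg (g n ω))).trans (hgC n)
  obtain ⟨F₂, hF₂, φ₂, hφ₂, H₂⟩ := exists_subseq_forall_injective_cesaro_tendsto_of_nonneg
    (f := fun n ω => max (-g (φ₁ n) ω) 0) (fun n => (hgm _).neg.max measurable_const)
    (fun n ω => le_max_right _ 0) (fun n => hni _) (C := C)
    fun n => (integral_mono (hni _) (hgi _).abs fun ω =>
      max_le (neg_le_abs (g (φ₁ n) ω)) (abs_nonneg (g (φ₁ n) ω))).trans (hgC _)
  refine ⟨fun ω => F₁ ω - F₂ ω, hF₁.sub hF₂, φ₁ ∘ φ₂, hφ₁.comp hφ₂, fun ψ hψ π hπ => ?_⟩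
  have hσ : Function.Injective (ψ ∘ π) := hψ.injective.comp hπ.injective
  filter_upwards [H₁ (φ₂ ∘ ψ ∘ π) (hφ₂.injective.comp hσ), H₂ (ψ ∘ π) hσ, ae_all_iff.2 hfg]
    with ω h1 h2 h3
  refine (h1.sub h2).congr fun n => ?_
  rw [← sub_div, ← Finset.sum_sub_distrib]
  congr 1
  refine Finset.sum_congr rfl fun k _ => ?_
  simp only [Function.comp_apply, h3]
  exact max_zero_sub_max_neg_zero_eq_self (g _ ω)
end

section
/- Let (Ω, Σ, μ) be a probability space and (f_n)_{n≥1} a sequence of non-negative real-valued random variables on Ω such that b := lim_{k→∞} sup_n μ({f_n ≥ k}) > 0 (the limit exists since k ↦ sup_n μ({f_n ≥ k}) is non-increasing). Then there exist a measurable set C with μ(C) > 0 and a strictly increasing map φ : ℕ → ℕ such that, setting g_n = f_{φ(n)}: (1) for every strictly increasing ψ : ℕ → ℕ and every bijection π : ℕ → ℕ, the Cesàro means (1/n) ∑_{k=1}^n g_{ψ(π(k))}(ω) tend to +∞ for μ-almost every ω ∈ C; and (2) lim_{k→∞} sup_n μ({ω ∈ C^c : g_n(ω) ≥ k}) = 0.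 -/
open MeasureTheory Filter Topology

/-- Bounded sequences in a real Hilbert space have weakly convergent subsequences. -/
theorem exists_subseq_tendsto_inner {E : Type*} [NormedAddCommGroup E] [InnerProductSpace ℝ E]
    [CompleteSpace E] (x : ℕ → E) (r : ℝ) (hx : ∀ n, ‖x n‖ ≤ r) :
    ∃ (h : E) (φ : ℕ → ℕ), StrictMono φ ∧
      ∀ y, Tendsto (fun n => inner ℝ (x (φ n)) y) atTop (𝓝 (inner ℝ h y)) := by
  set K : Submodule ℝ E := (Submodule.span ℝ (Set.range x)).topologicalClosure
  have hxK : ∀ n, x n ∈ K := fun n =>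
    Submodule.le_topologicalClosure _ (Submodule.subset_span ⟨n, rfl⟩)
  have hKc : IsClosed (K : Set E) := Submodule.isClosed_topologicalClosure _
  have : CompleteSpace K := hKc.completeSpace_coe
  have : TopologicalSpace.SeparableSpace K :=
    ((Set.countable_range x).isSeparable.span (R := ℝ)).closure.separableSpace
  let ℓ : ℕ → WeakDual ℝ K := fun n =>
    StrongDual.toWeakDual (InnerProductSpace.toDual ℝ K ⟨x n, hxK n⟩)
  obtain ⟨a, -, φ, hφ, ha⟩ := WeakDual.isSeqCompact_closedBall ℝ K 0 r (x := ℓ) (fun n => by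
    change InnerProductSpace.toDual ℝ K ⟨x n, hxK n⟩ ∈ Metric.closedBall 0 r
    simpa using hx n)
  let h : K := (InnerProductSpace.toDual ℝ K).symm (WeakDual.toStrongDual a)
  refine ⟨h, φ, hφ, fun y => ?_⟩
  have key : ∀ z : K, inner ℝ (z : E) y = inner ℝ z (K.orthogonalProjectionOnto y) := fun z => by
    simp
  have h1 := ((WeakDual.eval_continuous (K.orthogonalProjectionOnto y)).tendsto a).comp ha
  have h2 : inner ℝ (h : E) y = a (K.orthogonalProjectionOnto y) := by
    rw [key, InnerProductSpace.toDual_symm_apply]; rfl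
  rw [h2]
  refine h1.congr fun n => ?_
  exact (key ⟨x (φ n), hxK (φ n)⟩).symm

/-- A weakly null sequence has a subsequence with rapidly decaying mutual inner products. -/
theorem exists_subseq_abs_inner_le {E : Type*} [NormedAddCommGroup E] [InnerProductSpace ℝ E]
    (u : ℕ → E) (hu : ∀ y, Tendsto (fun n => inner ℝ (u n) y) atTop (𝓝 0)) :
    ∃ φ : ℕ → ℕ, StrictMono φ ∧
      ∀ i j, i ≠ j → |inner ℝ (u (φ i)) (u (φ j))| ≤ (1 / 2 : ℝ) ^ i + (1 / 2 : ℝ) ^ j := by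
  obtain ⟨φ, -, hφ⟩ := exists_seq_of_forall_finset_exists (fun _ : ℕ => True)
    (fun i j => i < j ∧ |inner ℝ (u j) (u i)| ≤ (1 / 2 : ℝ) ^ i) (fun s _ => by
      have : ∀ᶠ j in atTop, ∀ i ∈ s, i < j ∧ |inner ℝ (u j) (u i)| ≤ (1 / 2 : ℝ) ^ i := by
        rw [Filter.eventually_all_finset]
        intro i _
        refine (eventually_gt_atTop i).and ?_
        have := (hu (u i)).abs
        rw [abs_zero] at this
        exact this.eventually_le_const (by positivity)
      obtain ⟨j, hj⟩ := this.exists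
      exact ⟨j, trivial, hj⟩)
  have hmono : StrictMono φ := fun m n hmn => (hφ m n hmn).1
  have hlt : ∀ i j, i < j → |inner ℝ (u (φ j)) (u (φ i))| ≤ (1 / 2 : ℝ) ^ i := fun i j hij =>
    (hφ i j hij).2.trans (pow_le_pow_of_le_one (by norm_num) (by norm_num) (hmono.le_apply))
  refine ⟨φ, hmono, fun i j hij => ?_⟩
  have hi : (0 : ℝ) < (1 / 2) ^ i := by positivity
  have hj : (0 : ℝ) < (1 / 2) ^ j := by positivity
  rcases hij.lt_or_gt with h | h
  · rw [real_inner_comm]; linarith [hlt i j h]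
  · linarith [hlt j i h]

theorem sum_half_pow_comp_injective_le {σ : ℕ → ℕ} (hσ : Function.Injective σ) (s : Finset ℕ) :
    ∑ k ∈ s, (1 / 2 : ℝ) ^ σ k ≤ 2 := by
  rw [← Finset.sum_image (f := fun k => (1 / 2 : ℝ) ^ k) (fun _ _ _ _ h => hσ h)]
  exact (summable_geometric_two.sum_le_tsum _ fun _ _ => by positivity).trans_eq
    tsum_geometric_two

/-- Sums of almost orthogonal bounded vectors grow at most like the square root of their number,
whatever the order in which the vectors are taken. -/
theorem norm_sum_comp_sq_le {E : Type*} [NormedAddCommGroup E] [InnerProductSpace ℝ E]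
    {u : ℕ → E} {B : ℝ} (hB : ∀ n, ‖u n‖ ^ 2 ≤ B)
    (hu : ∀ i j, i ≠ j → |inner ℝ (u i) (u j)| ≤ (1 / 2 : ℝ) ^ i + (1 / 2 : ℝ) ^ j)
    {σ : ℕ → ℕ} (hσ : Function.Injective σ) (n : ℕ) :
    ‖∑ k ∈ Finset.range n, u (σ k)‖ ^ 2 ≤ (B + 4) * n := by
  rw [← real_inner_self_eq_norm_sq, sum_inner]
  simp_rw [inner_sum]
  have hterm : ∀ k l, inner ℝ (u (σ k)) (u (σ l)) ≤
      (if k = l then B else 0) + ((1 / 2 : ℝ) ^ σ k + (1 / 2 : ℝ) ^ σ l) := fun k l => by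
    split_ifs with h
    · subst h
      rw [real_inner_self_eq_norm_sq]
      have : (0 : ℝ) < (1 / 2) ^ σ k := by positivity
      linarith [hB (σ k)]
    · rw [zero_add]
      exact (le_abs_self _).trans (hu _ _ (hσ.ne h))
  refine (Finset.sum_le_sum fun k _ => Finset.sum_le_sum fun l _ => hterm k l).trans ?_
  have hs := sum_half_pow_comp_injective_le hσ (Finset.range n)
  have hn : (0 : ℝ) ≤ n := Nat.cast_nonneg n
  have hdiag : ∑ k ∈ Finset.range n, ∑ l ∈ Finset.range n, (if k = l then B else 0) = n * B := by
    rw [Finset.sum_congr rfl fun k hk => by rw [Finset.sum_ite_eq, if_pos hk]]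
    simp
  simp only [Finset.sum_add_distrib, hdiag, Finset.sum_const, Finset.card_range, nsmul_eq_mul,
    ← Finset.mul_sum]
  nlinarith

theorem ae_tendsto_zero_of_summable_norm_sq {Ω : Type*} [MeasurableSpace Ω] {μ : Measure Ω}
    {v : ℕ → Lp ℝ 2 μ} (hv : Summable fun m => ‖v m‖ ^ 2) :
    ∀ᵐ ω ∂μ, Tendsto (fun m => v m ω) atTop (𝓝 0) := by
  have hnorm : ∀ m, ∫⁻ ω, ‖v m ω‖ₑ ^ 2 ∂μ = ENNReal.ofReal (‖v m‖ ^ 2) := fun m => by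
    have := eLpNorm_nnreal_pow_eq_lintegral (f := v m) (μ := μ) (p := 2) (by norm_num)
    norm_num at this
    rw [← this, Lp.norm_def, ENNReal.ofReal_pow ENNReal.toReal_nonneg,
      ENNReal.ofReal_toReal (Lp.eLpNorm_ne_top _)]
  have hmeas : ∀ m, AEMeasurable (fun ω => ‖v m ω‖ₑ ^ 2) μ := fun m =>
    ((Lp.stronglyMeasurable (v m)).measurable.enorm.pow_const 2).aemeasurable
  have hfin : ∫⁻ ω, ∑' m, ‖v m ω‖ₑ ^ 2 ∂μ ≠ ⊤ := by
    rw [lintegral_tsum hmeas]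
    simp_rw [hnorm]
    exact hv.tsum_ofReal_ne_top
  filter_upwards [ae_lt_top' (AEMeasurable.tsum hmeas) hfin] with ω hω
  have h0 := ENNReal.tendsto_atTop_zero_of_tsum_ne_top hω.ne
  have h1 : Tendsto (fun m => (v m ω) ^ 2) atTop (𝓝 0) := by
    have := (ENNReal.tendsto_toReal ENNReal.zero_ne_top).comp h0
    simpa [Function.comp_def] using this
  have h2 := h1.sqrt
  simp only [Real.sqrt_sq_eq_abs, Real.sqrt_zero] at h2
  exact (tendsto_zero_iff_abs_tendsto_zero _).2 h2

/-- If means of `a ∘ σ` along the squares converge to a positive limit and `j * a j ≤ g j`,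
the means of `g ∘ σ` diverge to `+∞`. -/
theorem tendsto_cesaro_atTop_of_squares {a g : ℕ → ℝ} (ha0 : ∀ j, 0 ≤ a j) (ha1 : ∀ j, a j ≤ 1)
    (hg0 : ∀ j, 0 ≤ g j) (hg : ∀ j, j * a j ≤ g j) {σ : ℕ → ℕ} (hσ : Function.Injective σ)
    {c : ℝ} (hc : 0 < c)
    (hlim : Tendsto (fun m : ℕ => ((m : ℝ) ^ 2)⁻¹ * ∑ k ∈ Finset.range (m ^ 2), a (σ k))
      atTop (𝓝 c)) :
    Tendsto (fun n : ℕ => (∑ k ∈ Finset.range n, g (σ k)) / n) atTop atTop := by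
  rw [tendsto_atTop]
  intro M
  obtain ⟨K, hK⟩ := exists_nat_ge ((M + 1) * 8 / c)
  rw [div_le_iff₀ hc] at hK
  have hsqrt : Tendsto Nat.sqrt atTop atTop :=
    tendsto_atTop.2 fun b => (eventually_ge_atTop (b * b)).mono fun n hn => Nat.le_sqrt.2 hn
  have hev := hsqrt.eventually
    ((hlim.eventually_const_le (half_lt_self hc)).and (eventually_ge_atTop 1))
  filter_upwards [hev, eventually_ge_atTop (K ^ 2 + 1)] with n hn hnK
  obtain ⟨hn, hm1⟩ := hn
  set m := Nat.sqrt n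
  have hmn : m ^ 2 ≤ n := by simpa [sq] using Nat.sqrt_le n
  have hnm : n ≤ (m + 1) ^ 2 := by simpa [sq] using (Nat.lt_succ_sqrt n).le
  have hm1' : (1 : ℝ) ≤ m := by exact_mod_cast hm1
  have hnm' : (n : ℝ) ≤ (m + 1) ^ 2 := by exact_mod_cast hnm
  have hnK' : (K : ℝ) ^ 2 + 1 ≤ n := by exact_mod_cast hnK
  have hsub : ∑ k ∈ Finset.range (m ^ 2), a (σ k) ≤ ∑ k ∈ Finset.range n, a (σ k) :=
    Finset.sum_le_sum_of_subset_of_nonneg (Finset.range_mono hmn) fun _ _ _ => ha0 _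
  rw [inv_mul_eq_div, le_div_iff₀ (by positivity)] at hn
  have hsum : c * n / 8 ≤ ∑ k ∈ Finset.range n, a (σ k) := by
    have h4 : (n : ℝ) ≤ 4 * m ^ 2 := by nlinarith
    linarith [mul_le_mul_of_nonneg_left h4 hc.le]
  have hpoint : ∀ j, K * a j - (if j < K then (K : ℝ) else 0) ≤ g j := fun j => by
    split_ifs with h
    · nlinarith [ha1 j, hg0 j, (Nat.cast_nonneg K : (0 : ℝ) ≤ K)]
    · have : (K : ℝ) ≤ j := by exact_mod_cast not_lt.1 h
      nlinarith [ha0 j, hg j]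
  have hcard : ∑ k ∈ Finset.range n, (if σ k < K then (K : ℝ) else 0) ≤ K * K := by
    rw [← Finset.sum_filter, Finset.sum_const, nsmul_eq_mul]
    have : ((Finset.range n).filter fun k => σ k < K).card ≤ (Finset.range K).card :=
      Finset.card_le_card_of_injOn σ (fun k hk => by simpa using (Finset.mem_filter.1 hk).2)
        hσ.injOn
    rw [Finset.card_range] at this
    gcongr
  have htot : K * ∑ k ∈ Finset.range n, a (σ k) - K * K ≤ ∑ k ∈ Finset.range n, g (σ k) := by
    have := Finset.sum_le_sum fun k (_ : k ∈ Finset.range n) => hpoint (σ k)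
    rw [Finset.sum_sub_distrib, ← Finset.mul_sum] at this
    linarith
  have hn0 : (0 : ℝ) < n := by nlinarith
  rw [le_div_iff₀ hn0]
  have hK0 : (0 : ℝ) ≤ K := Nat.cast_nonneg K
  have h1 := mul_le_mul_of_nonneg_left hsum hK0
  have h2 := mul_le_mul_of_nonneg_right hK hn0.le
  nlinarith

/-- A sequence in `L²` whose deviations from `h` are bounded and almost orthogonal satisfies the
strong law of large numbers along the squares, for every injective reindexing. -/
theorem ae_tendsto_mean_squares {Ω : Type*} [MeasurableSpace Ω] {μ : Measure Ω}
    {x : ℕ → Lp ℝ 2 μ} {h : Lp ℝ 2 μ} {B : ℝ} (hB : ∀ n, ‖x n - h‖ ^ 2 ≤ B)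
    (hu : ∀ i j, i ≠ j → |inner ℝ (x i - h) (x j - h)| ≤ (1 / 2 : ℝ) ^ i + (1 / 2 : ℝ) ^ j)
    {σ : ℕ → ℕ} (hσ : Function.Injective σ) :
    ∀ᵐ ω ∂μ, Tendsto
      (fun m : ℕ => ((m : ℝ) ^ 2)⁻¹ * ∑ k ∈ Finset.range (m ^ 2), x (σ k) ω)
      atTop (𝓝 (h ω)) := by
  let v : ℕ → Lp ℝ 2 μ := fun m =>
    ((m : ℝ) ^ 2)⁻¹ • ∑ k ∈ Finset.range (m ^ 2), (x (σ k) - h)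
  have hv : Summable fun m => ‖v m‖ ^ 2 := by
    refine Summable.of_nonneg_of_le (fun _ => by positivity) (fun m => ?_)
      ((Real.summable_nat_pow_inv.2 one_lt_two).mul_left (B + 4))
    have hsum := norm_sum_comp_sq_le (u := fun n => x n - h) hB hu hσ (m ^ 2)
    rw [norm_smul, mul_pow, Real.norm_of_nonneg (by positivity)]
    rcases Nat.eq_zero_or_pos m with rfl | hm
    · simp
    · have hm' : (0 : ℝ) < m := by exact_mod_cast hm
      calc (((m : ℝ) ^ 2)⁻¹) ^ 2 * ‖∑ k ∈ Finset.range (m ^ 2), (x (σ k) - h)‖ ^ 2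
          ≤ (((m : ℝ) ^ 2)⁻¹) ^ 2 * ((B + 4) * (m ^ 2 : ℕ)) := by gcongr
        _ = (B + 4) * ((m : ℝ) ^ 2)⁻¹ := by
          push_cast
          field_simp
  have hcoe : ∀ᵐ ω ∂μ, ∀ m, v m ω =
      ((m : ℝ) ^ 2)⁻¹ * ∑ k ∈ Finset.range (m ^ 2), (x (σ k) ω - h ω) := by
    have hsub : ∀ᵐ ω ∂μ, ∀ k, (x (σ k) - h : Lp ℝ 2 μ) ω = x (σ k) ω - h ω :=
      ae_all_iff.2 fun k => Lp.coeFn_sub _ _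
    refine ae_all_iff.2 fun m => ?_
    filter_upwards [hsub, Lp.coeFn_smul ((m : ℝ) ^ 2)⁻¹
      (∑ k ∈ Finset.range (m ^ 2), (x (σ k) - h)),
      Lp.coeFn_finsetSum (Finset.range (m ^ 2)) (fun k => x (σ k) - h)] with ω h1 h2 h3
    simp only [v]
    rw [h2, Pi.smul_apply, smul_eq_mul, h3, Finset.sum_apply]
    simp_rw [h1]
  filter_upwards [ae_tendsto_zero_of_summable_norm_sq hv, hcoe] with ω h1 h2
  have h3 := h1.add_const (h ω)
  rw [zero_add] at h3
  refine h3.congr' ?_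
  filter_upwards [eventually_ge_atTop 1] with m hm
  have hm' : (m : ℝ) ≠ 0 := by positivity
  rw [h2, Finset.sum_sub_distrib, Finset.sum_const, Finset.card_range, nsmul_eq_mul]
  push_cast
  field_simp
  ring

/-- From a sequence of events one can extract a subsequence that, for some `h ∈ L²`, converges
weakly to `h` and whose means along the squares converge to `h` a.e. for every injective
reindexing. -/
theorem exists_subseq_measure_inter_tendsto_and_mean_squares {Ω : Type*} [MeasurableSpace Ω]
    {μ : Measure Ω} [IsProbabilityMeasure μ] {A : ℕ → Set Ω} (hA : ∀ n, MeasurableSet (A n)) :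
    ∃ (h : Lp ℝ 2 μ) (θ : ℕ → ℕ), StrictMono θ ∧
      (∀ S, MeasurableSet S →
        Tendsto (fun n => μ.real (A (θ n) ∩ S)) atTop (𝓝 (∫ ω in S, h ω ∂μ))) ∧
      ∀ σ : ℕ → ℕ, Function.Injective σ → ∀ᵐ ω ∂μ, Tendsto
        (fun m : ℕ => ((m : ℝ) ^ 2)⁻¹ *
          ∑ k ∈ Finset.range (m ^ 2), (A (θ (σ k))).indicator (fun _ => (1 : ℝ)) ω)
        atTop (𝓝 (h ω)) := by
  let x : ℕ → Lp ℝ 2 μ := fun n => indicatorConstLp 2 (hA n) (measure_ne_top μ _) 1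
  have hx : ∀ n, ‖x n‖ ≤ 1 := fun n => by
    simp only [x]
    rw [norm_indicatorConstLp (by norm_num) (by norm_num), norm_one, one_mul]
    exact Real.rpow_le_one measureReal_nonneg measureReal_le_one (by norm_num)
  obtain ⟨h, θ₁, hθ₁, hweak⟩ := exists_subseq_tendsto_inner x 1 hx
  obtain ⟨θ₂, hθ₂, horth⟩ := exists_subseq_abs_inner_le (fun n => x (θ₁ n) - h) (fun y => by
    simpa [inner_sub_left] using (hweak y).sub_const (inner ℝ h y))
  refine ⟨h, θ₁ ∘ θ₂, hθ₁.comp hθ₂, fun S hS => ?_, fun σ hσ => ?_⟩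
  · have := (hweak (indicatorConstLp 2 hS (measure_ne_top μ _) 1)).comp hθ₂.tendsto_atTop
    rw [real_inner_comm, L2.inner_indicatorConstLp_one] at this
    refine this.congr fun n => ?_
    exact L2.real_inner_indicatorConstLp_one_indicatorConstLp_one _ _ _ _
  · have hB : ∀ n, ‖x (θ₁ (θ₂ n)) - h‖ ^ 2 ≤ (1 + ‖h‖) ^ 2 := fun n => by
      gcongr
      exact (norm_sub_le _ _).trans (by gcongr; exact hx _)
    have hind : ∀ᵐ ω ∂μ, ∀ n, x n ω = (A n).indicator (fun _ => (1 : ℝ)) ω :=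
      ae_all_iff.2 fun n => indicatorConstLp_coeFn
    filter_upwards [ae_tendsto_mean_squares hB horth hσ, hind] with ω h1 h2
    simpa [h2] using h1

theorem tendsto_measure_natCast_le {Ω : Type*} [MeasurableSpace Ω] (μ : Measure Ω)
    [IsFiniteMeasure μ] {g : Ω → ℝ} (hg : Measurable g) :
    Tendsto (fun k : ℕ => μ {ω | (k : ℝ) ≤ g ω}) atTop (𝓝 0) := by
  have hempty : ⋂ k : ℕ, {ω | (k : ℝ) ≤ g ω} = ∅ := by
    ext ω
    obtain ⟨k, hk⟩ := exists_nat_gt (g ω)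
    simpa using ⟨k, hk⟩
  rw [← measure_empty (μ := μ), ← hempty]
  exact tendsto_measure_iInter_atTop
    (fun k => (measurableSet_le measurable_const hg).nullMeasurableSet)
    (fun i j hij ω (hω : (j : ℝ) ≤ g ω) => (Nat.cast_le.2 hij).trans hω)
    ⟨0, measure_ne_top μ _⟩

/-- Every level below the limit of the tail suprema is exceeded by infinitely many tails. -/
theorem frequently_lt_measure_natCast_le {Ω : Type*} [MeasurableSpace Ω] {μ : Measure Ω}
    [IsFiniteMeasure μ] {f : ℕ → Ω → ℝ} (hmeas : ∀ n, Measurable (f n)) {b c : ENNReal}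
    (hlim : Tendsto (fun k : ℕ => ⨆ n, μ {ω | (k : ℝ) ≤ f n ω}) atTop (𝓝 b)) (hc : c < b)
    (k : ℕ) : ∃ᶠ n in atTop, c < μ {ω | (k : ℝ) ≤ f n ω} := by
  intro hcon
  simp only [not_lt] at hcon
  obtain ⟨N, hN⟩ := eventually_atTop.1 hcon
  obtain ⟨d, hcd, hdb⟩ := exists_between hc
  have hsmall : ∀ᶠ j : ℕ in atTop, ∀ n ∈ Finset.range N, μ {ω | (j : ℝ) ≤ f n ω} ≤ d :=
    (Filter.eventually_all_finset _).2 fun n _ =>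
      (tendsto_measure_natCast_le μ (hmeas n)).eventually_le_const (bot_le.trans_lt hcd)
  refine hdb.not_ge (le_of_tendsto hlim ?_)
  filter_upwards [hsmall, eventually_ge_atTop k] with j hj hkj
  refine iSup_le fun n => ?_
  rcases lt_or_ge n N with hn | hn
  · exact hj n (Finset.mem_range.2 hn)
  · refine (measure_mono fun ω (hω : (j : ℝ) ≤ f n ω) => ?_).trans ((hN n hn).trans hcd.le)
    exact (Nat.cast_le.2 hkj).trans hω

/-- If the events `{t n ≤ g n}`, with levels `t n → ∞`, exhaust the limiting tail mass `b` and
asymptotically leave `S`, then `g` is bounded in probability on `S`. -/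
theorem tendsto_iSup_measure_inter_tail {Ω : Type*} [MeasurableSpace Ω] {μ : Measure Ω}
    [IsFiniteMeasure μ] {g : ℕ → Ω → ℝ} (hmeas : ∀ n, Measurable (g n)) {S : Set Ω}
    (hS : MeasurableSet S) {b : ENNReal} {s : ℕ → ENNReal} (hs : Tendsto s atTop (𝓝 b))
    (hbound : ∀ (k : ℕ) n, μ {ω | (k : ℝ) ≤ g n ω} ≤ s k) {t : ℕ → ℕ} (ht : Tendsto t atTop atTop)
    (hfull : Tendsto (fun n => μ {ω | (t n : ℝ) ≤ g n ω}) atTop (𝓝 b))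
    (hleave : Tendsto (fun n => μ ({ω | (t n : ℝ) ≤ g n ω} ∩ S)) atTop (𝓝 0)) :
    Tendsto (fun k : ℕ => ⨆ n, μ {ω | ω ∈ S ∧ (k : ℝ) ≤ g n ω}) atTop (𝓝 0) := by
  have hb : b ≠ ⊤ := fun h => by
    have := le_of_tendsto hfull (Eventually.of_forall fun n => measure_mono (Set.subset_univ _))
    exact measure_ne_top μ Set.univ (top_le_iff.1 (h ▸ this))
  rw [ENNReal.tendsto_nhds_zero]
  intro ε hε
  rcases eq_or_ne ε ⊤ with rfl | hεt
  · simp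
  set δ := ε / 3
  have hδ0 : 0 < δ := ENNReal.div_pos hε.ne' (by norm_num)
  have hδt : δ ≠ ⊤ := ENNReal.div_ne_top hεt (by norm_num)
  have hδ3 : δ + δ + δ = ε := ENNReal.add_thirds ε
  obtain ⟨M, hM⟩ := (hs.eventually_le_const (ENNReal.lt_add_right hb hδ0.ne')).exists
  have hfull' : ∀ᶠ n in atTop, b ≤ μ {ω | (t n : ℝ) ≤ g n ω} + δ := by
    exact (hfull.add_const δ).eventually_const_le (ENNReal.lt_add_right hb hδ0.ne')
  obtain ⟨N, hN⟩ := eventually_atTop.1 ((hfull'.and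
    (hleave.eventually_le_const hδ0)).and (ht.eventually_ge_atTop M))
  have hsmall : ∀ᶠ k : ℕ in atTop, ∀ n ∈ Finset.range N, μ {ω | (k : ℝ) ≤ g n ω} ≤ ε :=
    (Filter.eventually_all_finset _).2 fun n _ =>
      (tendsto_measure_natCast_le μ (hmeas n)).eventually_le_const hε
  filter_upwards [hsmall, eventually_ge_atTop M] with k hk hMk
  refine iSup_le fun n => ?_
  rcases lt_or_ge n N with hn | hn
  · exact (measure_mono fun ω hω => hω.2).trans (hk n (Finset.mem_range.2 hn))
  obtain ⟨⟨hn1, hn2⟩, hn3⟩ := hN n hn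
  set T := {ω | (t n : ℝ) ≤ g n ω}
  set D := {ω | ω ∈ S ∧ (k : ℝ) ≤ g n ω}
  have hDm : MeasurableSet D := hS.inter (measurableSet_le measurable_const (hmeas n))
  have hunion : T ∪ D ⊆ {ω | (M : ℝ) ≤ g n ω} := by
    rintro ω (hω | hω)
    · exact le_trans (Nat.cast_le.2 hn3) (show (t n : ℝ) ≤ g n ω from hω)
    · exact (Nat.cast_le.2 hMk).trans hω.2
  have hinter : μ (T ∩ D) ≤ δ :=
    (measure_mono (Set.inter_subset_inter_right T fun ω hω => hω.1)).trans hn2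
  have hkey : μ T + μ D ≤ μ T + ε := by
    calc μ T + μ D = μ (T ∪ D) + μ (T ∩ D) := (measure_union_add_inter T hDm).symm
      _ ≤ (b + δ) + δ := by
        gcongr
        exact (measure_mono hunion).trans ((hbound M n).trans hM)
      _ ≤ (μ T + δ + δ) + δ := by gcongr
      _ = μ T + ε := by rw [← hδ3]; ring
  exact (ENNReal.add_le_add_iff_left (measure_ne_top μ T)).1 hkey

/-- Lemma 2: if `b := lim_k sup_n μ {f_n ≥ k} > 0`, there is a non-negligible set `C`
and a subsequence `g` such that Cesàro means of every permuted subsequence of `g`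
tend to `+∞` a.e. on `C`, while `lim_k sup_n μ {g_n 1_{Cᶜ} ≥ k} = 0`. -/
theorem exists_blowup_set_of_limsup_pos
    {Ω : Type*} [MeasurableSpace Ω] (μ : Measure Ω) [IsProbabilityMeasure μ]
    (f : ℕ → Ω → ℝ) (hmeas : ∀ n, Measurable (f n)) (hnonneg : ∀ n ω, 0 ≤ f n ω)
    (b : ENNReal) (hb : 0 < b)
    (hlim : Tendsto (fun k : ℕ => ⨆ n, μ {ω | (k : ℝ) ≤ f n ω}) atTop (𝓝 b)) :
    ∃ C : Set Ω, MeasurableSet C ∧ 0 < μ C ∧ ∃ φ : ℕ → ℕ, StrictMono φ ∧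
      ((∀ ψ : ℕ → ℕ, StrictMono ψ → ∀ π : ℕ → ℕ, Function.Bijective π →
        ∀ᵐ ω ∂μ.restrict C, Tendsto
          (fun n : ℕ => (∑ k ∈ Finset.range n, f (φ (ψ (π k))) ω) / n)
          atTop atTop) ∧
      Tendsto (fun k : ℕ => ⨆ n, μ {ω | ω ∈ Cᶜ ∧ (k : ℝ) ≤ f (φ n) ω}) atTop (𝓝 0)) := by
  obtain ⟨c, -, hcb, hc⟩ := exists_seq_strictMono_tendsto' hb
  obtain ⟨φ, hφ, hφc⟩ := extraction_forall_of_frequently fun k =>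
    frequently_lt_measure_natCast_le hmeas hlim (hcb k).2 k
  let A : ℕ → Set Ω := fun k => {ω | (k : ℝ) ≤ f (φ k) ω}
  have hA : ∀ k, MeasurableSet (A k) := fun k => measurableSet_le measurable_const (hmeas _)
  have hAb : Tendsto (fun k => μ (A k)) atTop (𝓝 b) :=
    tendsto_of_tendsto_of_tendsto_of_le_of_le hc hlim (fun k => (hφc k).le)
      fun k => le_iSup (fun n => μ {ω | (k : ℝ) ≤ f n ω}) (φ k)
  have hbt : b ≠ ⊤ :=
    ne_top_of_le_ne_top ENNReal.one_ne_top
      (le_of_tendsto hAb (Eventually.of_forall fun _ => prob_le_one))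
  obtain ⟨h, θ, hθ, hweak, hmean⟩ :=
    exists_subseq_measure_inter_tendsto_and_mean_squares (μ := μ) hA
  have hAθ : Tendsto (fun n => μ (A (θ n))) atTop (𝓝 b) := hAb.comp hθ.tendsto_atTop
  have hint : ∫ ω, h ω ∂μ = b.toReal := by
    have h1 := hweak Set.univ MeasurableSet.univ
    simp only [Set.inter_univ, setIntegral_univ] at h1
    exact tendsto_nhds_unique h1 ((ENNReal.tendsto_toReal hbt).comp hAθ)
  let C : Set Ω := {ω | 0 < h ω}
  have hC : MeasurableSet C :=
    measurableSet_lt measurable_const (Lp.stronglyMeasurable h).measurable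
  refine ⟨C, hC, ?_, φ ∘ θ, hφ.comp hθ, fun ψ hψ π hπ => ?_, ?_⟩
  · refine pos_iff_ne_zero.2 fun hC0 => ?_
    have hle : ∀ᵐ ω ∂μ, h ω ≤ 0 := by
      filter_upwards [measure_eq_zero_iff_ae_notMem.1 hC0] with ω hω
      exact not_lt.1 hω
    exact ((ENNReal.toReal_pos hb.ne' hbt).trans_eq hint.symm).not_ge (integral_nonpos_of_ae hle)
  · rw [ae_restrict_iff' hC]
    have hinj : Function.Injective (ψ ∘ π) := hψ.injective.comp hπ.injective
    filter_upwards [hmean _ hinj] with ω hω hωC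
    refine tendsto_cesaro_atTop_of_squares
      (a := fun j => (A (θ j)).indicator (fun _ => (1 : ℝ)) ω) (g := fun j => f (φ (θ j)) ω)
      (fun j => Set.indicator_nonneg (fun _ _ => zero_le_one) _)
      (fun j => Set.indicator_le_self' (fun _ _ => zero_le_one) _) (fun j => hnonneg _ _)
      (fun j => ?_) hinj hωC hω
    by_cases hj : ω ∈ A (θ j)
    · rw [Set.indicator_of_mem hj, mul_one]
      exact (Nat.cast_le.2 hθ.le_apply).trans hj
    · rw [Set.indicator_of_notMem hj, mul_zero]
      exact hnonneg _ _
  · refine tendsto_iSup_measure_inter_tail (fun n => hmeas (φ (θ n))) hC.compl hlim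
      (fun k n => le_iSup (fun n => μ {ω | (k : ℝ) ≤ f n ω}) (φ (θ n))) hθ.tendsto_atTop hAθ ?_
    have h1 := hweak Cᶜ hC.compl
    have hle : ∫ ω in Cᶜ, h ω ∂μ ≤ 0 :=
      setIntegral_nonpos hC.compl fun ω hω => not_lt.1 hω
    have h0 : ∫ ω in Cᶜ, h ω ∂μ = 0 :=
      hle.antisymm (ge_of_tendsto h1 (Eventually.of_forall fun _ => measureReal_nonneg))
    rw [h0] at h1
    exact (ENNReal.tendsto_toReal_iff (fun _ => measure_ne_top μ _) ENNReal.zero_ne_top).1 h1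
end
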